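/- arXiv:2207.00201 — 3 statements merged into one kernel-verified Lean document; each statement's English description precedes it below -/
import Mathlib

section
/- For each n ≥ 2 let V_n be a real symmetric strictly positive definite n×n matrix, let t⁽ⁿ⁾ ∈ ℝⁿ be a nonzero vector, let μ ∈ ℝ, σ > 0, and let G⁽ⁿ⁾ be a random vector in ℝⁿ with the centered multivariate Gaussian distribution with covariance V_n. Set X⁽ⁿ⁾ = μ t⁽ⁿ⁾ + σ G⁽ⁿ⁾, μ̂_n = ((t⁽ⁿ⁾)ᵀ V_n^{−1} X⁽ⁿ⁾)/((t⁽ⁿ⁾)ᵀ V_n^{−1} t⁽ⁿ⁾), and σ̂²_n = (1/n)·[((X⁽ⁿ⁾)ᵀ V_n^{−1} X⁽ⁿ⁾)((t⁽ⁿ⁾)ᵀ V_n^{−1} t⁽ⁿ⁾) − ((t⁽ⁿ⁾)ᵀ V_n^{−1} X⁽ⁿ⁾)²]/((t⁽ⁿ⁾)ᵀ V_n^{−1} t⁽ⁿ⁾). Define Y_n = (1/σ)·√((t⁽ⁿ⁾)ᵀ V_n^{−1} t⁽ⁿ⁾)·(μ̂_n − μ) and Q_n = (1/σ²)·√(n/2)·(σ̂²_n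 − σ²). Then the pair (Y_n, Q_n) converges in distribution, as n → ∞, to the standard bivariate normal distribution N₂(0, I₂). -/
open Matrix Real MeasureTheory ProbabilityTheory Filter

/-- The centered multivariate Gaussian measure on `Fin n → ℝ` with (strictly positive
definite) covariance matrix `V`, given by its density with respect to Lebesgue measure. -/
noncomputable def mvGaussian (n : ℕ) (V : Matrix (Fin n) (Fin n) ℝ) :
    Measure (Fin n → ℝ) :=
  volume.withDensity fun x =>
    ENNReal.ofReal ((Real.sqrt ((2 * Real.pi) ^ n * V.det))⁻¹ *
      Real.exp (-(1 / 2) * (x ⬝ᵥ (V⁻¹ *ᵥ x))))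

/-- The maximum likelihood estimator of the drift parameter `μ`. -/
noncomputable def muHat (n : ℕ) (V : Matrix (Fin n) (Fin n) ℝ) (t X : Fin n → ℝ) : ℝ :=
  (t ⬝ᵥ (V⁻¹ *ᵥ X)) / (t ⬝ᵥ (V⁻¹ *ᵥ t))

/-- The maximum likelihood estimator of the variance parameter `σ²`. -/
noncomputable def sigmaHatSq (n : ℕ) (V : Matrix (Fin n) (Fin n) ℝ)
    (t X : Fin n → ℝ) : ℝ :=
  (1 / (n : ℝ)) *
    (((X ⬝ᵥ (V⁻¹ *ᵥ X)) * (t ⬝ᵥ (V⁻¹ *ᵥ t)) - (t ⬝ᵥ (V⁻¹ *ᵥ X)) ^ 2) /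
      (t ⬝ᵥ (V⁻¹ *ᵥ t)))

/-- The normalized drift estimator `Y_n`. -/
noncomputable def Ystat (n : ℕ) (V : Matrix (Fin n) (Fin n) ℝ) (t : Fin n → ℝ)
    (μ σ : ℝ) (g : Fin n → ℝ) : ℝ :=
  (1 / σ) * Real.sqrt (t ⬝ᵥ (V⁻¹ *ᵥ t)) * (muHat n V t (μ • t + σ • g) - μ)

/-- The normalized variance estimator `Q_n`. -/
noncomputable def Qstat (n : ℕ) (V : Matrix (Fin n) (Fin n) ℝ) (t : Fin n → ℝ)
    (μ σ : ℝ) (g : Fin n → ℝ) : ℝ :=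
  (1 / σ ^ 2) * Real.sqrt ((n : ℝ) / 2) *
    (sigmaHatSq n V t (μ • t + σ • g) - σ ^ 2)

open scoped Topology

lemma pi_gaussianReal_eq_mvGaussian_one (n : ℕ) :
    Measure.pi (fun _ : Fin n => gaussianReal 0 1) = mvGaussian n 1 := by
  have hdens : ∀ x : Fin n → ℝ,
      (√((2 * π) ^ n * (1 : Matrix (Fin n) (Fin n) ℝ).det))⁻¹ *
        rexp (-(1 / 2) * (x ⬝ᵥ ((1 : Matrix (Fin n) (Fin n) ℝ)⁻¹ *ᵥ x))) =
      ∏ i, gaussianPDFReal 0 1 (x i) := by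
    intro x
    have hsqrt : √((2 * π) ^ n) = √(2 * π) ^ n := by
      rw [Real.sqrt_eq_iff_mul_self_eq (by positivity) (by positivity), ← mul_pow,
        Real.mul_self_sqrt (by positivity)]
    simp only [gaussianPDFReal, det_one, mul_one, inv_one, one_mulVec, Finset.prod_mul_distrib,
      ← Real.exp_sum, hsqrt, NNReal.coe_one, Finset.prod_const, Finset.card_univ, Fintype.card_fin,
      inv_pow]
    simp [dotProduct, Finset.mul_sum, div_eq_inv_mul, pow_two]
  refine Measure.pi_eq fun s hs => ?_
  have hint : ∀ i, Integrable ((s i).indicator (gaussianPDFReal 0 1)) := fun i =>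
    (integrable_gaussianPDFReal 0 1).indicator (hs i)
  have hind : (Set.univ.pi s).indicator (fun x : Fin n → ℝ => ∏ i, gaussianPDFReal 0 1 (x i)) =
      fun x => ∏ i, (s i).indicator (gaussianPDFReal 0 1) (x i) := by
    ext x
    by_cases hx : x ∈ Set.univ.pi s
    · rw [Set.indicator_of_mem hx]
      exact Finset.prod_congr rfl fun i _ => (Set.indicator_of_mem (hx i trivial) _).symm
    · rw [Set.indicator_of_notMem hx]
      obtain ⟨i, hi⟩ : ∃ i, x i ∉ s i := by simpa [Set.mem_pi] using hx
      exact (Finset.prod_eq_zero (Finset.mem_univ i) (Set.indicator_of_notMem hi _)).symm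
  have hmeas : MeasurableSet (Set.univ.pi s) := MeasurableSet.univ_pi hs
  rw [mvGaussian, withDensity_apply _ hmeas]
  simp_rw [hdens]
  rw [← ofReal_integral_eq_lintegral_ofReal, ← integral_indicator hmeas, hind,
    integral_fintype_prod_volume_eq_prod, ENNReal.ofReal_prod_of_nonneg]
  · refine Finset.prod_congr rfl fun i _ => ?_
    rw [integral_indicator (hs i), gaussianReal_apply_eq_integral 0 one_ne_zero]
  · exact fun i _ => integral_nonneg fun x =>
      Set.indicator_nonneg (fun y _ => gaussianPDFReal_nonneg 0 1 y) x
  · exact (Integrable.fintype_prod fun _ => integrable_gaussianPDFReal 0 1).integrableOn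
  · exact ae_of_all _ fun x => Finset.prod_nonneg fun i _ => gaussianPDFReal_nonneg 0 1 _

lemma dotProduct_mulVec_mulVec_mulVec_of_eq_one {n : ℕ} {W A : Matrix (Fin n) (Fin n) ℝ}
    (hA : Aᵀ * W * A = 1) (x : Fin n → ℝ) : (A *ᵥ x) ⬝ᵥ (W *ᵥ (A *ᵥ x)) = x ⬝ᵥ x := by
  rw [dotProduct_comm, dotProduct_mulVec, ← mulVec_transpose, mulVec_mulVec, mulVec_mulVec, hA,
    one_mulVec]

lemma mvGaussian_eq_map {n : ℕ} {V A : Matrix (Fin n) (Fin n) ℝ} (hV : V.PosDef)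
    (hA : Aᵀ * V⁻¹ * A = 1) :
    mvGaussian n V = (mvGaussian n 1).map (A *ᵥ ·) := by
  have hVdet : 0 < V.det := hV.det_pos
  have hdet : A.det ^ 2 = V.det := by
    have h := congrArg det hA
    rw [det_mul, det_mul, det_transpose, det_nonsing_inv, Ring.inverse_eq_inv', det_one] at h
    field_simp at h
    exact h
  have hA0 : A.det ≠ 0 := by
    rintro h
    rw [h] at hdet
    simp [← hdet] at hVdet
  have hmA : Measurable (A *ᵥ ·) := by fun_prop
  have habs : 0 < |A.det| := abs_pos.2 hA0
  have hdens : ∀ x : Fin n → ℝ,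
      ENNReal.ofReal ((√((2 * π) ^ n * (1 : Matrix (Fin n) (Fin n) ℝ).det))⁻¹ *
        rexp (-(1 / 2) * (x ⬝ᵥ ((1 : Matrix (Fin n) (Fin n) ℝ)⁻¹ *ᵥ x)))) =
      ENNReal.ofReal |A.det| * ENNReal.ofReal ((√((2 * π) ^ n * V.det))⁻¹ *
        rexp (-(1 / 2) * ((A *ᵥ x) ⬝ᵥ (V⁻¹ *ᵥ (A *ᵥ x))))) := by
    intro x
    rw [← ENNReal.ofReal_mul habs.le, dotProduct_mulVec_mulVec_mulVec_of_eq_one hA, ← hdet,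
      Real.sqrt_mul (x := (2 * π) ^ n) (by positivity) (A.det ^ 2),
      Real.sqrt_sq_eq_abs]
    simp only [det_one, mul_one, inv_one, one_mulVec]
    field_simp
  have hmeas : Measurable fun x : Fin n → ℝ => ENNReal.ofReal ((√((2 * π) ^ n * V.det))⁻¹ *
      rexp (-(1 / 2) * (x ⬝ᵥ (V⁻¹ *ᵥ x)))) := by
    have : Continuous fun x : Fin n → ℝ => x ⬝ᵥ (V⁻¹ *ᵥ x) := by fun_prop
    fun_prop
  have hvol : Measure.map (A *ᵥ ·) (volume : Measure (Fin n → ℝ)) =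
      ENNReal.ofReal |A.det⁻¹| • volume := Real.map_matrix_volume_pi_eq_smul_volume_pi hA0
  ext s hs
  rw [Measure.map_apply hmA hs, mvGaussian, mvGaussian, withDensity_apply _ hs,
    withDensity_apply _ (hmA hs)]
  simp only [hdens]
  symm
  have hcm := lintegral_const_mul (μ := volume.restrict ((A *ᵥ ·) ⁻¹' s)) (ENNReal.ofReal |A.det|)
    (hmeas.comp hmA)
  simp only [Function.comp_def] at hcm
  rw [hcm, ← setLIntegral_map hs hmeas hmA, hvol,
    Measure.restrict_smul, lintegral_smul_measure, smul_eq_mul, ← mul_assoc,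
    ← ENNReal.ofReal_mul habs.le, abs_inv, mul_inv_cancel₀ habs.ne']
  simp

open scoped MatrixOrder in
lemma exists_whitening {m : ℕ} {V : Matrix (Fin (m + 1)) (Fin (m + 1)) ℝ} (hV : V.PosDef)
    {t : Fin (m + 1) → ℝ} (ht : t ≠ 0) :
    ∃ (A : Matrix (Fin (m + 1)) (Fin (m + 1)) ℝ) (s : ℝ), 0 < s ∧ Aᵀ * V⁻¹ * A = 1 ∧
      t ⬝ᵥ (V⁻¹ *ᵥ t) = s ^ 2 ∧ ∀ x, t ⬝ᵥ (V⁻¹ *ᵥ (A *ᵥ x)) = s * x 0 := by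
  obtain ⟨B, hB⟩ := CStarAlgebra.nonneg_iff_eq_star_mul_self.mp hV.inv.posSemidef.nonneg
  replace hB : V⁻¹ = Bᵀ * B := by simpa [star_eq_conjTranspose] using hB
  have hBdet : IsUnit B.det := by
    have h : V⁻¹.det ≠ 0 := hV.inv.det_pos.ne'
    rw [hB, det_mul, det_transpose] at h
    exact isUnit_iff_ne_zero.2 (left_ne_zero_of_mul h)
  set u : EuclideanSpace ℝ (Fin (m + 1)) := WithLp.toLp 2 (B *ᵥ t) with hu
  have hu0 : u ≠ 0 := by
    intro h
    refine ht ?_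
    have h' : B *ᵥ t = 0 := by simpa [hu] using h
    rw [← one_mulVec t, ← nonsing_inv_mul B hBdet, ← mulVec_mulVec, h', mulVec_zero]
  have hun : 0 < ‖u‖ := norm_pos_iff.2 hu0
  obtain ⟨b, hb⟩ := Orthonormal.exists_orthonormalBasis_extension_of_card_eq (𝕜 := ℝ)
    (E := EuclideanSpace ℝ (Fin (m + 1))) (ι := Fin (m + 1)) (by simp)
    (v := fun _ => ‖u‖⁻¹ • u) (s := {0})
    (by
      constructor
      · intro i
        simp [norm_smul, hun.ne']
      · intro i j hij
        exact absurd (Subsingleton.elim i j) hij)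
  have hub : u = ‖u‖ • b 0 := by
    rw [hb 0 rfl, smul_smul, mul_inv_cancel₀ hun.ne', one_smul]
  set O : Matrix (Fin (m + 1)) (Fin (m + 1)) ℝ := Matrix.of fun i j => b j i with hO
  have hinner : ∀ i j, ∑ k, b i k * b j k = if i = j then 1 else 0 := by
    intro i j
    rw [← orthonormal_iff_ite.1 b.orthonormal i j]
    simp [PiLp.inner_apply, mul_comm]
  have hOO : Oᵀ * O = 1 := by
    ext i j
    simp [mul_apply, hO, hinner, one_apply]
  have hOu : (B *ᵥ t) ᵥ* O = Pi.single 0 ‖u‖ := by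
    ext j
    have hcoord : ∀ i, (B *ᵥ t) i = ‖u‖ * b 0 i := fun i => by
      have := congrArg (fun v : EuclideanSpace ℝ (Fin (m + 1)) => v i) hub
      simpa [hu] using this
    simp only [vecMul, dotProduct, hcoord, hO, of_apply, mul_assoc, ← Finset.mul_sum, hinner]
    by_cases h : j = 0
    · subst h; simp
    · simp [h, Ne.symm h]
  have hBA : B * (B⁻¹ * O) = O := by rw [← Matrix.mul_assoc, mul_nonsing_inv B hBdet, one_mul]
  refine ⟨B⁻¹ * O, ‖u‖, hun, ?_, ?_, fun x => ?_⟩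
  · calc (B⁻¹ * O)ᵀ * V⁻¹ * (B⁻¹ * O) = (B * (B⁻¹ * O))ᵀ * (B * (B⁻¹ * O)) := by
          rw [hB, transpose_mul B]; simp only [Matrix.mul_assoc]
      _ = 1 := by rw [hBA, hOO]
  · rw [hB, ← mulVec_mulVec, dotProduct_mulVec, vecMul_transpose, EuclideanSpace.norm_sq_eq]
    simp [dotProduct, hu, pow_two]
  · rw [hB, ← mulVec_mulVec, dotProduct_mulVec, vecMul_transpose, mulVec_mulVec, hBA,
      dotProduct_mulVec, hOu]
    simp

lemma integral_pow_four_gaussianReal : ∫ x, x ^ 4 ∂gaussianReal 0 1 = 3 := by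
  have hderiv : ∀ p p' : ℝ → ℝ, (∀ t, HasDerivAt p (p' t) t) →
      deriv (fun t => p t * rexp (t ^ 2 / 2)) =
        fun t => (p' t + t * p t) * rexp (t ^ 2 / 2) := by
    intro p p' hp
    ext t
    have h : HasDerivAt (fun t : ℝ => rexp (t ^ 2 / 2)) (rexp (t ^ 2 / 2) * t) t := by
      have := (((hasDerivAt_id t).pow 2).div_const 2).exp
      convert! this using 1
      simp
    rw [((hp t).fun_mul h).deriv]
    ring
  have hmgf : mgf (fun x => x) (gaussianReal 0 1) = fun t => 1 * rexp (t ^ 2 / 2) := by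
    rw [mgf_fun_id_gaussianReal]
    simp
  have h : iteratedDeriv 4 (mgf (fun x => x) (gaussianReal 0 1)) 0 =
      ∫ x, x ^ 4 ∂gaussianReal 0 1 := by
    rw [iteratedDeriv_mgf_zero] <;> simp
  rw [← h, hmgf, iteratedDeriv_succ, iteratedDeriv_succ, iteratedDeriv_succ, iteratedDeriv_one,
    hderiv (fun _ => 1) (fun _ => 0) (fun t => hasDerivAt_const t 1),
    hderiv (fun t => 0 + t * 1) (fun _ => 1) (fun t => by
      simpa using hasDerivAt_id' t),
    hderiv (fun t => 1 + t * (0 + t * 1)) (fun t => 2 * t) (fun t => by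
      simpa [pow_two] using ((hasDerivAt_id t).pow 2).const_add 1),
    hderiv (fun t => 2 * t + t * (1 + t * (0 + t * 1))) (fun t => 3 + 3 * t ^ 2) (fun t => by
      have := ((hasDerivAt_id t).const_mul 3).add ((hasDerivAt_id t).pow 3)
      convert! this using 1
      · ext y; simp; ring
      · simp)]
  simp

lemma integral_sq_gaussianReal : ∫ x, x ^ 2 ∂gaussianReal 0 1 = 1 := by
  have h := variance_fun_id_gaussianReal (μ := 0) (v := 1)
  rw [variance_eq_integral measurable_id'.aemeasurable] at h
  simpa using h

lemma tendsto_sqrt_div_succ :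
    Tendsto (fun m : ℕ => √((m : ℝ) / (m + 1))) atTop (𝓝 1) := by
  simpa using (tendsto_natCast_div_add_atTop (1 : ℝ)).sqrt

lemma tendsto_integral_sum_sq_gaussianReal (h : BoundedContinuousFunction ℝ ℝ) :
    Tendsto (fun m : ℕ =>
        ∫ y, h (√(((m : ℝ) + 1) / 2) * ((∑ i, y i ^ 2) / ((m : ℝ) + 1) - 1))
          ∂Measure.pi (fun _ : Fin m => gaussianReal 0 1))
      atTop (𝓝 (∫ q, h q ∂gaussianReal 0 1)) := by
  set P : Measure (ℕ → ℝ) := Measure.infinitePi fun _ => gaussianReal 0 1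
  set X : ℕ → (ℕ → ℝ) → ℝ := fun k ω => (ω k ^ 2 - 1) / √2 with hX
  have hmp : ∀ k, MeasurePreserving (fun ω : ℕ → ℝ => ω k) P (gaussianReal 0 1) := fun k =>
    measurePreserving_eval_infinitePi _ k
  have hindep : iIndepFun X P :=
    iIndepFun_infinitePi (X := fun _ x => (x ^ 2 - 1) / √2) fun _ => by fun_prop
  have hident : ∀ k, IdentDistrib (X k) (X 0) P P := fun k =>
    (IdentDistrib.mk (hmp k).aemeasurable (hmp 0).aemeasurable
      ((hmp k).map_eq.trans (hmp 0).map_eq.symm)).comp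
      (u := fun x => (x ^ 2 - 1) / √2) (by fun_prop)
  have hpow : ∀ k : ℕ, Integrable (fun x : ℝ => x ^ k) (gaussianReal 0 1) := fun k =>
    integrable_pow_of_mem_interior_integrableExpSet (by simp) k
  have hmean : P[X 0] = 0 := by
    have := integral_map (hmp 0).aemeasurable (f := fun x : ℝ => (x ^ 2 - 1) / √2) (by fun_prop)
    rw [(hmp 0).map_eq, integral_div, integral_sub (hpow 2) (by simp),
      integral_sq_gaussianReal] at this
    simp only [hX, ← this]
    simp
  have hvar : P[X 0 ^ 2] = 1 := by
    have hsq : ∀ x : ℝ, ((x ^ 2 - 1) / √2) ^ 2 = (x ^ 4 - 2 * x ^ 2 + 1) / 2 := fun x => by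
      rw [div_pow, Real.sq_sqrt (by norm_num)]
      ring
    have h42 : Integrable (fun x : ℝ => x ^ 4 - 2 * x ^ 2) (gaussianReal 0 1) :=
      (hpow 4).sub ((hpow 2).const_mul 2)
    have := integral_map (hmp 0).aemeasurable
      (f := fun x : ℝ => (x ^ 4 - 2 * x ^ 2 + 1) / 2) (by fun_prop)
    rw [(hmp 0).map_eq, integral_div, integral_add h42 (by simp),
      integral_sub (hpow 4) ((hpow 2).const_mul 2), integral_const_mul, integral_sq_gaussianReal,
      integral_pow_four_gaussianReal] at this
    simp only [hX, Pi.pow_apply, hsq, ← this]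
    simp
    norm_num
  have hclt := tendstoInDistribution_inv_sqrt_mul_sum (Y := id) HasLaw.id hmean hvar hindep hident
  have hconst : TendstoInMeasure P
      (fun (m : ℕ) _ => (√((m : ℝ) / (m + 1)), -(√(2 * ((m : ℝ) + 1)))⁻¹)) atTop
      (fun _ => ((1 : ℝ), (0 : ℝ))) := by
    refine tendstoInMeasure_of_tendsto_ae (fun m => by fun_prop) (ae_of_all _ fun _ => ?_)
    refine tendsto_sqrt_div_succ.prodMk_nhds ?_
    rw [← neg_zero]
    refine (tendsto_inv_atTop_zero.comp (Real.tendsto_sqrt_atTop.comp ?_)).neg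
    exact (tendsto_atTop_add_const_right _ 1 tendsto_natCast_atTop_atTop).const_mul_atTop
      (by norm_num)
  have hslutsky := hclt.continuous_comp_prodMk_of_tendstoInMeasure_const
    (g := fun p : ℝ × (ℝ × ℝ) => p.2.1 * p.1 + p.2.2) (by fun_prop) hconst
    (fun m => by fun_prop)
  have hlim := ProbabilityMeasure.tendsto_iff_forall_integral_tendsto.1 hslutsky.tendsto h
  have hlimit : ∫ q, h q ∂Measure.map (fun ω : ℝ => (1 : ℝ) * id ω + 0) (gaussianReal 0 1) =
      ∫ q, h q ∂gaussianReal 0 1 := by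
    simp
  simp only [ProbabilityMeasure.coe_mk] at hlim
  rw [hlimit] at hlim
  refine hlim.congr fun m => ?_
  have hrestr : P.map (fun ω (i : Fin m) => ω i) = Measure.pi fun _ => gaussianReal 0 1 := by
    have hi : iIndepFun (fun (k : ℕ) (ω : ℕ → ℝ) => ω k) P :=
      iIndepFun_infinitePi (X := fun _ x => x) fun _ => measurable_id
    rw [(iIndepFun_iff_map_fun_eq_pi_map fun i => (hmp _).aemeasurable).1
      (hi.precomp Fin.val_injective)]
    simp only [(hmp _).map_eq]
  rw [← hrestr, integral_map (hslutsky.forall_aemeasurable m) (by fun_prop),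
    integral_map (measurable_pi_lambda _ fun _ => measurable_pi_apply _).aemeasurable
      (Continuous.aestronglyMeasurable (by fun_prop))]
  refine integral_congr_ae (ae_of_all _ fun ω => congrArg h ?_)
  have hsum : ∑ k ∈ Finset.range m, X k ω = ((∑ i : Fin m, ω i ^ 2) - m) / √2 := by
    rw [hX, ← Finset.sum_div, Finset.sum_sub_distrib, Finset.sum_range]
    simp
  rcases Nat.eq_zero_or_pos m with rfl | hm
  · simp
  have hm' : (0 : ℝ) < m := Nat.cast_pos.2 hm
  have hm1 : (0 : ℝ) < (m : ℝ) + 1 := by positivity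
  dsimp only
  rw [hsum, Real.sqrt_div hm'.le, Real.sqrt_div hm1.le, Real.sqrt_mul (by norm_num)]
  have h1 : 0 < √(m : ℝ) := Real.sqrt_pos.2 hm'
  have h2 : 0 < √((m : ℝ) + 1) := Real.sqrt_pos.2 hm1
  have h3 : √((m : ℝ) + 1) ^ 2 = (m : ℝ) + 1 := Real.sq_sqrt hm1.le
  field_simp
  rw [h3]
  ring

lemma statistics_mulVec {m : ℕ} {V A : Matrix (Fin (m + 1)) (Fin (m + 1)) ℝ}
    {t : Fin (m + 1) → ℝ} {s μ σ : ℝ} (hV : V.PosDef) (hs : 0 < s) (hσ : 0 < σ)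
    (hA : Aᵀ * V⁻¹ * A = 1) (htt : t ⬝ᵥ (V⁻¹ *ᵥ t) = s ^ 2)
    (htA : ∀ x, t ⬝ᵥ (V⁻¹ *ᵥ (A *ᵥ x)) = s * x 0) (x : Fin (m + 1) → ℝ) :
    Ystat (m + 1) V t μ σ (A *ᵥ x) = x 0 ∧
      Qstat (m + 1) V t μ σ (A *ᵥ x) =
        √(((m : ℝ) + 1) / 2) * ((∑ i : Fin m, x i.succ ^ 2) / ((m : ℝ) + 1) - 1) := by
  have hsymm : ∀ y z : Fin (m + 1) → ℝ, y ⬝ᵥ (V⁻¹ *ᵥ z) = z ⬝ᵥ (V⁻¹ *ᵥ y) := fun y z => by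
    have h : (V⁻¹)ᵀ = V⁻¹ := by simpa [IsHermitian] using hV.inv.isHermitian
    rw [dotProduct_comm, dotProduct_mulVec, ← mulVec_transpose, h]
  have hlin : t ⬝ᵥ (V⁻¹ *ᵥ (μ • t + σ • (A *ᵥ x))) = μ * s ^ 2 + σ * (s * x 0) := by
    simp only [mulVec_add, mulVec_smul, dotProduct_add, dotProduct_smul, smul_eq_mul, htt, htA]
  have hquad : (μ • t + σ • (A *ᵥ x)) ⬝ᵥ (V⁻¹ *ᵥ (μ • t + σ • (A *ᵥ x))) =
      μ ^ 2 * s ^ 2 + 2 * μ * σ * (s * x 0) + σ ^ 2 * (x 0 ^ 2 + ∑ i : Fin m, x i.succ ^ 2) := by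
    have hxx : x ⬝ᵥ x = x 0 ^ 2 + ∑ i : Fin m, x i.succ ^ 2 := by
      simp [dotProduct, Fin.sum_univ_succ, pow_two]
    simp only [mulVec_add, mulVec_smul, dotProduct_add, dotProduct_smul, smul_eq_mul,
      add_dotProduct, smul_dotProduct, hsymm (A *ᵥ x) t, htt, htA,
      dotProduct_mulVec_mulVec_mulVec_of_eq_one hA, hxx]
    ring
  constructor
  · rw [Ystat, muHat, hlin, htt, Real.sqrt_sq hs.le]
    field_simp
    ring
  · rw [Qstat, sigmaHatSq, hlin, hquad, htt]
    push_cast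
    field_simp
    ring

lemma integral_statistics_eq {m : ℕ} {V : Matrix (Fin (m + 1)) (Fin (m + 1)) ℝ}
    {t : Fin (m + 1) → ℝ} (hV : V.PosDef) (ht : t ≠ 0) (μ : ℝ) {σ : ℝ} (hσ : 0 < σ)
    (f : BoundedContinuousFunction (ℝ × ℝ) ℝ) :
    ∫ g, f (Ystat (m + 1) V t μ σ g, Qstat (m + 1) V t μ σ g) ∂mvGaussian (m + 1) V =
      ∫ x, ∫ y, f (x, √(((m : ℝ) + 1) / 2) * ((∑ i, y i ^ 2) / ((m : ℝ) + 1) - 1))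
        ∂Measure.pi (fun _ : Fin m => gaussianReal 0 1) ∂gaussianReal 0 1 := by
  obtain ⟨A, s, hs, hA, htt, htA⟩ := exists_whitening hV ht
  have hmeas : Continuous fun g => (Ystat (m + 1) V t μ σ g, Qstat (m + 1) V t μ σ g) := by
    unfold Ystat Qstat muHat sigmaHatSq
    fun_prop
  rw [mvGaussian_eq_map hV hA, integral_map (by fun_prop) (by fun_prop),
    ← pi_gaussianReal_eq_mvGaussian_one]
  simp only [statistics_mulVec hV hs hσ hA htt htA]
  have hmp := measurePreserving_piFinSuccAbove (fun _ : Fin (m + 1) => gaussianReal 0 1) 0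
  rw [← hmp.integral_comp' (g := fun p : ℝ × (Fin m → ℝ) =>
    f (p.1, √(((m : ℝ) + 1) / 2) * ((∑ i, p.2 i ^ 2) / ((m : ℝ) + 1) - 1))) |>.trans
    (integral_prod _ ?_)]
  · rfl
  · refine .of_bound (Continuous.aestronglyMeasurable (by fun_prop)) ‖f‖ ?_
    exact ae_of_all _ fun p => f.norm_coe_le_norm _

theorem bivariate_clt
    (V : (n : ℕ) → Matrix (Fin n) (Fin n) ℝ)
    (t : (n : ℕ) → Fin n → ℝ)
    (hV : ∀ n : ℕ, 2 ≤ n → (V n).PosDef)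
    (ht : ∀ n : ℕ, 2 ≤ n → t n ≠ 0)
    (μ σ : ℝ) (hσ : 0 < σ) :
    ∀ f : BoundedContinuousFunction (ℝ × ℝ) ℝ,
      Tendsto (fun n : ℕ =>
          ∫ g, f (Ystat n (V n) (t n) μ σ g, Qstat n (V n) (t n) μ σ g)
            ∂(mvGaussian n (V n)))
        atTop
        (nhds (∫ p, f p ∂((gaussianReal 0 1).prod (gaussianReal 0 1)))) := by
  intro f
  rw [← tendsto_add_atTop_iff_nat 1, integral_prod _ (f.integrable _)]
  have hlim : Tendsto (fun m : ℕ =>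
      ∫ x, ∫ y, f (x, √(((m : ℝ) + 1) / 2) * ((∑ i, y i ^ 2) / ((m : ℝ) + 1) - 1))
        ∂Measure.pi (fun _ : Fin m => gaussianReal 0 1) ∂gaussianReal 0 1)
      atTop (𝓝 (∫ x, ∫ q, f (x, q) ∂gaussianReal 0 1 ∂gaussianReal 0 1)) := by
    refine tendsto_integral_of_dominated_convergence (fun _ => ‖f‖) (fun m => ?_)
      (integrable_const _) (fun m => ae_of_all _ fun x => ?_) (ae_of_all _ fun x => ?_)
    · refine StronglyMeasurable.aestronglyMeasurable ?_
      refine StronglyMeasurable.integral_prod_right (f := fun x (y : Fin m → ℝ) =>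
        f (x, √(((m : ℝ) + 1) / 2) * ((∑ i, y i ^ 2) / ((m : ℝ) + 1) - 1))) ?_
      exact Continuous.stronglyMeasurable (by fun_prop)
    · refine (norm_integral_le_of_norm_le_const (ae_of_all _ fun y => f.norm_coe_le_norm _)).trans ?_
      simp
    · exact tendsto_integral_sum_sq_gaussianReal
        (f.compContinuous ⟨fun q => (x, q), by fun_prop⟩)
  refine hlim.congr' ?_
  filter_upwards [eventually_ge_atTop 1] with m hm
  exact (integral_statistics_eq (hV _ (by omega)) (ht _ (by omega)) μ hσ f).symm
end

section
/- For n ≥ 2, let W_n be a random variable with the chi-square distribution with n − 1 degrees of freedom and set Q̄_n = (W_n − (n − 1))/√(2n). Then sup_{z ∈ ℝ} |P(Q̄_n ≤ z) − Φ(z)| ≤ √(2n − 1)/n, where Φ(z) = ∫_{−∞}^{z} (1/√(2π)) e^{−x²/2} dx is the standard normal distribution function. -/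
open MeasureTheory ProbabilityTheory Real Filter

/-- The standard normal distribution function. -/
noncomputable def stdNormalCDF (z : ℝ) : ℝ :=
  ∫ x in Set.Iic z, (1 / Real.sqrt (2 * Real.pi)) * Real.exp (-x ^ 2 / 2)

theorem stdNormalCDF_eq_setIntegral (z : ℝ) :
    stdNormalCDF z = ∫ x in Set.Iic z, gaussianPDFReal 0 1 x := by
  simp [stdNormalCDF, gaussianPDFReal, div_eq_inv_mul]

theorem continuous_gaussianPDFReal_std : Continuous (gaussianPDFReal 0 1) := by
  rw [gaussianPDFReal_def]
  fun_prop

theorem hasDerivAt_gaussianPDFReal_std (x : ℝ) :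
    HasDerivAt (gaussianPDFReal 0 1) (-x * gaussianPDFReal 0 1 x) x := by
  have h : HasDerivAt (fun y : ℝ => -(y - 0) ^ 2 / (2 * ((1 : NNReal) : ℝ))) (-x) x := by
    convert! ((((hasDerivAt_id x).sub_const 0).pow 2).neg.div_const (2 * ((1 : NNReal) : ℝ))) using 1
    simp
    ring
  rw [gaussianPDFReal_def]
  convert! h.exp.const_mul ((√(2 * π * ((1 : NNReal) : ℝ)))⁻¹) using 1
  ring

theorem gaussianPDFReal_std_neg (x : ℝ) :
    gaussianPDFReal 0 1 (-x) = gaussianPDFReal 0 1 x := by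
  simp [gaussianPDFReal]

theorem hasDerivAt_stdNormalCDF (x : ℝ) :
    HasDerivAt stdNormalCDF (gaussianPDFReal 0 1 x) x := by
  have hi := integrable_gaussianPDFReal 0 1
  have h : stdNormalCDF = fun y => stdNormalCDF 0 + ∫ t in (0 : ℝ)..y, gaussianPDFReal 0 1 t := by
    ext y
    rw [stdNormalCDF_eq_setIntegral, stdNormalCDF_eq_setIntegral,
      ← intervalIntegral.integral_Iic_sub_Iic hi.integrableOn hi.integrableOn]
    ring
  rw [h]
  exact (intervalIntegral.integral_hasDerivAt_right (hi.intervalIntegrable)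
    (continuous_gaussianPDFReal_std.stronglyMeasurableAtFilter _ _)
    continuous_gaussianPDFReal_std.continuousAt).const_add _

theorem stdNormalCDF_neg (x : ℝ) : stdNormalCDF (-x) = 1 - stdNormalCDF x := by
  have hi := integrable_gaussianPDFReal 0 1
  have h := integral_comp_neg_Iic (-x) (gaussianPDFReal 0 1)
  simp only [gaussianPDFReal_std_neg, neg_neg] at h
  have h1 := intervalIntegral.integral_Iic_add_Ioi (b := x) hi.integrableOn hi.integrableOn
  rw [integral_gaussianPDFReal_eq_one 0 one_ne_zero] at h1
  rw [stdNormalCDF_eq_setIntegral, stdNormalCDF_eq_setIntegral]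
  linarith

theorem stdNormalCDF_nonneg (x : ℝ) : 0 ≤ stdNormalCDF x := by
  rw [stdNormalCDF_eq_setIntegral]
  exact integral_nonneg fun t => gaussianPDFReal_nonneg 0 1 t

theorem stdNormalCDF_le_one (x : ℝ) : stdNormalCDF x ≤ 1 := by
  have h := stdNormalCDF_neg x
  linarith [stdNormalCDF_nonneg (-x)]

theorem monotone_stdNormalCDF : Monotone stdNormalCDF :=
  monotone_of_hasDerivAt_nonneg hasDerivAt_stdNormalCDF fun x => gaussianPDFReal_nonneg 0 1 x

/-- The ratio of the standard normal distribution function to its density. -/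
noncomputable def millsRatio (x : ℝ) : ℝ := stdNormalCDF x / gaussianPDFReal 0 1 x

theorem millsRatio_nonneg (x : ℝ) : 0 ≤ millsRatio x :=
  div_nonneg (stdNormalCDF_nonneg x) (gaussianPDFReal_nonneg 0 1 x)

theorem gaussianPDFReal_mul_millsRatio (x : ℝ) :
    gaussianPDFReal 0 1 x * millsRatio x = stdNormalCDF x :=
  mul_div_cancel₀ _ (gaussianPDFReal_pos 0 1 x one_ne_zero).ne'

theorem hasDerivAt_millsRatio (x : ℝ) : HasDerivAt millsRatio (1 + x * millsRatio x) x := by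
  have hp := (gaussianPDFReal_pos 0 1 x one_ne_zero).ne'
  convert! (hasDerivAt_stdNormalCDF x).div (hasDerivAt_gaussianPDFReal_std x) hp using 1
  rw [millsRatio]
  field_simp
  ring

theorem continuous_millsRatio : Continuous millsRatio :=
  continuous_iff_continuousAt.2 fun x => (hasDerivAt_millsRatio x).continuousAt

theorem one_add_mul_millsRatio_nonneg (x : ℝ) : 0 ≤ 1 + x * millsRatio x := by
  have hp := gaussianPDFReal_pos 0 1 x one_ne_zero
  have hi := integrable_gaussianPDFReal 0 1
  have hi' : Integrable fun t => -t * gaussianPDFReal 0 1 t := by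
    have h := (integrable_mul_exp_neg_mul_sq (b := 1 / 2) (by norm_num)).const_mul
      (-(√(2 * π))⁻¹)
    refine h.congr (Eventually.of_forall fun t => ?_)
    simp only [gaussianPDFReal, NNReal.coe_one, mul_one, sub_zero]
    rw [show -t ^ 2 / 2 = -(1 / 2) * t ^ 2 by ring]
    ring
  have hlim : Tendsto (gaussianPDFReal 0 1) atBot (nhds 0) :=
    tendsto_zero_of_hasDerivAt_of_integrableOn_Iic (a := 0)
      (fun t _ => hasDerivAt_gaussianPDFReal_std t) hi'.integrableOn hi.integrableOn
  have h1 := integral_Iic_of_hasDerivAt_of_tendsto' (a := x)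
    (fun t _ => hasDerivAt_gaussianPDFReal_std t) hi'.integrableOn hlim
  have h2 : 0 ≤ ∫ t in Set.Iic x, (x * gaussianPDFReal 0 1 t + -t * gaussianPDFReal 0 1 t) :=
    setIntegral_nonneg measurableSet_Iic fun t (ht : t ≤ x) => by
      have := mul_nonneg (sub_nonneg.2 ht) (gaussianPDFReal_nonneg 0 1 t)
      linarith
  rw [integral_add (hi.const_mul x).integrableOn hi'.integrableOn, integral_const_mul, h1,
    ← stdNormalCDF_eq_setIntegral] at h2
  rw [millsRatio, show 1 + x * (stdNormalCDF x / gaussianPDFReal 0 1 x) =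
    (gaussianPDFReal 0 1 x + x * stdNormalCDF x) / gaussianPDFReal 0 1 x by field_simp]
  exact div_nonneg (by linarith) hp.le

/-- The derivative of the solution of Stein's equation for a half-line is at most one. -/
theorem one_sub_stdNormalCDF_mul_le_one {x z : ℝ} (hxz : x ≤ z) :
    (1 - stdNormalCDF z) * (1 + x * millsRatio x) ≤ 1 := by
  have hz0 := stdNormalCDF_nonneg z
  have hz1 := stdNormalCDF_le_one z
  have hM := millsRatio_nonneg x
  rcases le_total x 0 with hx | hx
  · have h0 := one_add_mul_millsRatio_nonneg x
    nlinarith [mul_nonneg (neg_nonneg.2 hx) hM]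
  · have hmono := monotone_stdNormalCDF hxz
    have h1 := one_add_mul_millsRatio_nonneg (-x)
    have h2 := gaussianPDFReal_mul_millsRatio (-x)
    rw [gaussianPDFReal_std_neg, stdNormalCDF_neg] at h2
    have h3 := gaussianPDFReal_mul_millsRatio x
    have key : (1 - stdNormalCDF z) * (x * millsRatio x) ≤ stdNormalCDF z := calc
      _ ≤ (1 - stdNormalCDF x) * (x * millsRatio x) := by gcongr
      _ = (x * millsRatio (-x)) * (gaussianPDFReal 0 1 x * millsRatio x) := by rw [← h2]; ring
      _ ≤ 1 * stdNormalCDF x := by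
        rw [h3]
        exact mul_le_mul_of_nonneg_right (by linarith) (stdNormalCDF_nonneg x)
      _ ≤ stdNormalCDF z := by linarith
    linarith

theorem abs_one_sub_stdNormalCDF_mul_le_one {x z : ℝ} (hxz : x ≤ z) :
    |(1 - stdNormalCDF z) * (1 + x * millsRatio x)| ≤ 1 := by
  rw [abs_of_nonneg (mul_nonneg (sub_nonneg.2 (stdNormalCDF_le_one z))
    (one_add_mul_millsRatio_nonneg x))]
  exact one_sub_stdNormalCDF_mul_le_one hxz

theorem abs_stdNormalCDF_mul_le_one {x z : ℝ} (hzx : z ≤ x) :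
    |stdNormalCDF z * (1 + -x * millsRatio (-x))| ≤ 1 := by
  have h := abs_one_sub_stdNormalCDF_mul_le_one (neg_le_neg hzx)
  rwa [stdNormalCDF_neg, sub_sub_cancel] at h

/-- The unnormalised density of the chi-square distribution with `2 * a` degrees of freedom. -/
noncomputable def chiSquareWeight (a w : ℝ) : ℝ := w ^ (a - 1) * exp (-(1 / 2 * w))

theorem chiSquareWeight_nonneg (a : ℝ) {w : ℝ} (hw : 0 ≤ w) : 0 ≤ chiSquareWeight a w := by
  unfold chiSquareWeight
  positivity

theorem measurable_chiSquareWeight (a : ℝ) : Measurable (chiSquareWeight a) := by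
  unfold chiSquareWeight
  fun_prop

theorem chiSquareWeight_add_one (a : ℝ) {w : ℝ} (hw : 0 < w) :
    chiSquareWeight (a + 1) w = chiSquareWeight a w * w := by
  rw [chiSquareWeight, chiSquareWeight, show a + 1 - 1 = a - 1 + 1 by ring, rpow_add_one hw.ne']
  ring

theorem integral_chiSquareWeight {a : ℝ} (ha : 0 < a) :
    ∫ w in Set.Ioi 0, chiSquareWeight a w = 2 ^ a * Gamma a := by
  simp only [chiSquareWeight]
  rw [integral_rpow_mul_exp_neg_mul_Ioi ha (by norm_num)]
  norm_num

theorem integrableOn_chiSquareWeight {a : ℝ} (ha : 0 < a) :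
    IntegrableOn (chiSquareWeight a) (Set.Ioi 0) :=
  .of_integral_ne_zero (by
    have := Gamma_pos_of_pos ha
    rw [integral_chiSquareWeight ha]
    positivity)

theorem integral_chiSquareWeight_add_one {a : ℝ} (ha : 0 < a) :
    ∫ w in Set.Ioi 0, chiSquareWeight (a + 1) w =
      2 * a * ∫ w in Set.Ioi 0, chiSquareWeight a w := by
  rw [integral_chiSquareWeight ha, integral_chiSquareWeight (by linarith), Gamma_add_one ha.ne',
    rpow_add_one two_ne_zero]
  ring

theorem hasDerivAt_chiSquareWeight_add_one (a : ℝ) {w : ℝ} (hw : 0 < w) :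
    HasDerivAt (chiSquareWeight (a + 1)) (chiSquareWeight a w * (a - w / 2)) w := by
  have h : HasDerivAt (fun v : ℝ => -(1 / 2 * v)) (-(1 / 2)) w := by
    convert! ((hasDerivAt_id w).const_mul (1 / 2 : ℝ)).neg using 1
    ring
  have h1 := (hasDerivAt_rpow_const (p := a) (Or.inl hw.ne')).mul h.exp
  unfold chiSquareWeight
  simp only [add_sub_cancel_right]
  convert! h1 using 1
  have : w ^ a = w ^ (a - 1) * w := by
    rw [← rpow_add_one hw.ne']
    simp
  rw [this]
  ring

theorem continuous_chiSquareWeight_add_one {a : ℝ} (ha : 0 < a) :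
    Continuous (chiSquareWeight (a + 1)) := by
  unfold chiSquareWeight
  simp only [add_sub_cancel_right]
  exact (continuous_rpow_const ha.le).mul (by fun_prop)

theorem tendsto_chiSquareWeight (a : ℝ) : Tendsto (chiSquareWeight a) atTop (nhds 0) := by
  refine (tendsto_rpow_mul_exp_neg_mul_atTop_nhds_zero (a - 1) (1 / 2) (by norm_num)).congr
    fun w => ?_
  simp [chiSquareWeight]

/-- The mean of the quadratic `(1 - w / ν) ^ 2` under the chi-square distribution. -/
theorem integral_chiSquareWeight_mul_sq {a ν : ℝ} (ha : 0 < a) :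
    IntegrableOn (fun w => chiSquareWeight a w * (1 - w / ν) ^ 2) (Set.Ioi 0) ∧
    ∫ w in Set.Ioi 0, chiSquareWeight a w * (1 - w / ν) ^ 2 =
      ((1 - 2 * a / ν) ^ 2 + 4 * a / ν ^ 2) * ∫ w in Set.Ioi 0, chiSquareWeight a w := by
  have h0 := integrableOn_chiSquareWeight ha
  have h1 := (integrableOn_chiSquareWeight (by linarith : 0 < a + 1)).const_mul (-(2 / ν))
  have h2 := (integrableOn_chiSquareWeight (by linarith : 0 < a + 1 + 1)).const_mul (1 / ν ^ 2)
  have heq : Set.EqOn (fun w => chiSquareWeight a w + -(2 / ν) * chiSquareWeight (a + 1) w +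
      1 / ν ^ 2 * chiSquareWeight (a + 1 + 1) w)
      (fun w => chiSquareWeight a w * (1 - w / ν) ^ 2) (Set.Ioi 0) := fun w (hw : 0 < w) => by
    simp only [chiSquareWeight_add_one _ hw]
    ring
  refine ⟨((h0.add h1).add h2).congr_fun heq measurableSet_Ioi, ?_⟩
  have h01 : IntegrableOn (fun w => chiSquareWeight a w + -(2 / ν) * chiSquareWeight (a + 1) w)
      (Set.Ioi 0) := h0.add h1
  rw [← setIntegral_congr_fun measurableSet_Ioi heq, integral_add h01 h2, integral_add h0 h1,
    integral_const_mul, integral_const_mul,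
    integral_chiSquareWeight_add_one (by linarith : 0 < a + 1),
    integral_chiSquareWeight_add_one ha]
  ring

/-- A measurable function dominated by an affine function is integrable against the chi-square
weight. -/
theorem integrableOn_chiSquareWeight_mul {a ν : ℝ} (ha : 0 < a) {s : Set ℝ}
    (hs : MeasurableSet s) (hs0 : s ⊆ Set.Ioi 0) {g : ℝ → ℝ} (hg : Measurable g)
    (hb : ∀ w ∈ s, |g w| ≤ |1 - w / ν|) :
    IntegrableOn (fun w => chiSquareWeight a w * g w) s := by
  have h2 := (integral_chiSquareWeight_mul_sq (ν := ν) ha).1.add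
    ((integrableOn_chiSquareWeight ha).const_mul 1)
  refine Integrable.mono' (h2.mono_set hs0)
    ((measurable_chiSquareWeight a).mul hg).aestronglyMeasurable
    ((ae_restrict_iff' hs).2 (ae_of_all _ fun w hw => ?_))
  have hD := chiSquareWeight_nonneg a (le_of_lt (hs0 hw))
  have hle : |g w| ≤ (1 - w / ν) ^ 2 + 1 := by
    have := hb w hw
    rw [← sq_abs]
    nlinarith [sq_nonneg (|1 - w / ν| - 1), abs_nonneg (1 - w / ν)]
  rw [norm_mul, norm_eq_abs, norm_eq_abs, abs_of_nonneg hD]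
  simp only [Pi.add_apply]
  nlinarith [mul_le_mul_of_nonneg_left hle hD]

theorem integral_chiSquareWeight_mul_abs_le {a ν c : ℝ} (ha : 0 < a) (hc : 0 < c)
    (hc2 : (1 - 2 * a / ν) ^ 2 + 4 * a / ν ^ 2 = c ^ 2) :
    ∫ w in Set.Ioi 0, chiSquareWeight a w * |1 - w / ν| ≤
      c * ∫ w in Set.Ioi 0, chiSquareWeight a w := by
  obtain ⟨hi, hI⟩ := integral_chiSquareWeight_mul_sq (ν := ν) ha
  have h0 := (integrableOn_chiSquareWeight ha).const_mul (c / 2)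
  have h1 := hi.const_mul (1 / (2 * c))
  calc ∫ w in Set.Ioi 0, chiSquareWeight a w * |1 - w / ν|
      ≤ ∫ w in Set.Ioi 0, (1 / (2 * c) * (chiSquareWeight a w * (1 - w / ν) ^ 2) +
          c / 2 * chiSquareWeight a w) := by
        refine setIntegral_mono_on ?_ (h1.add h0) measurableSet_Ioi fun w (hw : 0 < w) => ?_
        · exact integrableOn_chiSquareWeight_mul (ν := ν) ha measurableSet_Ioi
            subset_rfl (by fun_prop) fun w _ => by simp
        · have hle : |1 - w / ν| ≤ 1 / (2 * c) * (1 - w / ν) ^ 2 + c / 2 := by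
            rw [← sq_abs (1 - w / ν)]
            have : 1 / (2 * c) * |1 - w / ν| ^ 2 + c / 2 - |1 - w / ν| =
              (|1 - w / ν| - c) ^ 2 / (2 * c) := by
              field_simp
              ring
            have : 0 ≤ (|1 - w / ν| - c) ^ 2 / (2 * c) := by positivity
            linarith
          nlinarith [mul_le_mul_of_nonneg_left hle (chiSquareWeight_nonneg a hw.le)]
    _ = c * ∫ w in Set.Ioi 0, chiSquareWeight a w := by
        rw [integral_add h1 h0, integral_const_mul, integral_const_mul, hI, hc2]
        field_simp
        ring

/-- The derivative of `w ↦ w ^ a * exp (-w / 2) * f ((w - 2 * a) / σ)`, where `σ ^ 2 = 2 * ν` and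
`f` solves the Stein equation `f' - x * f = b`. -/
theorem hasDerivAt_chiSquareWeight_mul_comp {a ν σ b f' w : ℝ} {f : ℝ → ℝ} (hσ : 0 < σ)
    (hσν : σ ^ 2 = 2 * ν) (hw : 0 < w) (hf : HasDerivAt f f' ((w - 2 * a) / σ))
    (hb : f' - (w - 2 * a) / σ * f ((w - 2 * a) / σ) = b) :
    HasDerivAt (fun v => chiSquareWeight (a + 1) v * f ((v - 2 * a) / σ))
      (σ / 2 * (chiSquareWeight a w * (b - (1 - w / ν) * f'))) w := by
  have hin : HasDerivAt (fun v : ℝ => (v - 2 * a) / σ) (1 / σ) w :=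
    ((hasDerivAt_id w).sub_const (2 * a)).div_const σ
  have h := (hasDerivAt_chiSquareWeight_add_one a hw).mul (hf.comp w hin)
  convert! h using 1
  simp only [Function.comp_apply]
  rw [← hb, chiSquareWeight_add_one a hw, show ν = σ ^ 2 / 2 by linarith]
  field_simp
  ring

/-- Berry-Esseen bound by Stein's method, for the unnormalised chi-square distribution. -/
theorem abs_integral_chiSquareWeight_sub_le {a ν σ c : ℝ} (ha : 0 < a) (hσ : 0 < σ)
    (hσν : σ ^ 2 = 2 * ν) (hc : 0 < c)
    (hc2 : (1 - 2 * a / ν) ^ 2 + 4 * a / ν ^ 2 = c ^ 2) (z : ℝ) :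
    |(∫ w in Set.Ioc 0 (max (2 * a + σ * z) 0), chiSquareWeight a w) -
        stdNormalCDF z * ∫ w in Set.Ioi 0, chiSquareWeight a w| ≤
      c * ∫ w in Set.Ioi 0, chiSquareWeight a w := by
  set m := max (2 * a + σ * z) 0 with hm
  have hm0 : 0 ≤ m := le_max_right _ _
  have hsub₁ : Set.Ioc 0 m ⊆ Set.Ioi (0 : ℝ) := Set.Ioc_subset_Ioi_self
  have hsub₂ : Set.Ioi m ⊆ Set.Ioi (0 : ℝ) := Set.Ioi_subset_Ioi hm0
  set t : ℝ → ℝ := fun w => (w - 2 * a) / σ with ht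
  have htc : Continuous t := by fun_prop
  have hMc := continuous_millsRatio
  have hle : ∀ w ∈ Set.Ioc 0 m, t w ≤ z := fun w hw => by
    have : w ≤ 2 * a + σ * z := (le_max_iff.1 hw.2).resolve_right (not_le.2 hw.1)
    rw [ht, div_le_iff₀ hσ]
    linarith
  have hge : ∀ w ∈ Set.Ioi m, z ≤ t w := fun w (hw : m < w) => by
    have : 2 * a + σ * z ≤ w := (le_max_left _ _).trans hw.le
    rw [ht, le_div_iff₀ hσ]
    linarith
  set Φ := stdNormalCDF z with hΦ
  have hΦ0 : 0 ≤ Φ := stdNormalCDF_nonneg z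
  have hΦ1 : Φ ≤ 1 := stdNormalCDF_le_one z
  set k₁ : ℝ → ℝ := fun w => (1 - Φ) * (1 + t w * millsRatio (t w)) with hk₁
  set k₂ : ℝ → ℝ := fun w => -(Φ * (1 + -t w * millsRatio (-t w))) with hk₂
  have hk₁c : Continuous k₁ := by fun_prop
  have hk₂c : Continuous k₂ := by fun_prop
  have hk₁b : ∀ w ∈ Set.Ioc 0 m, |k₁ w| ≤ 1 := fun w hw =>
    abs_one_sub_stdNormalCDF_mul_le_one (hle w hw)
  have hk₂b : ∀ w ∈ Set.Ioi m, |k₂ w| ≤ 1 := fun w hw => by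
    rw [hk₂, abs_neg]
    exact abs_stdNormalCDF_mul_le_one (hge w hw)
  have hprod : ∀ {w k : ℝ}, |k| ≤ 1 → |(1 - w / ν) * k| ≤ |1 - w / ν| := fun hk => by
    rw [abs_mul]
    exact mul_le_of_le_one_right (abs_nonneg _) hk
  have hi₁ : IntegrableOn (fun w => chiSquareWeight a w * ((1 - w / ν) * k₁ w)) (Set.Ioc 0 m) :=
    integrableOn_chiSquareWeight_mul (ν := ν) ha measurableSet_Ioc hsub₁
      (by fun_prop) fun w hw => hprod (hk₁b w hw)
  have hi₂ : IntegrableOn (fun w => chiSquareWeight a w * ((1 - w / ν) * k₂ w)) (Set.Ioi m) :=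
    integrableOn_chiSquareWeight_mul (ν := ν) ha measurableSet_Ioi hsub₂
      (by fun_prop) fun w hw => hprod (hk₂b w hw)
  have hD := integrableOn_chiSquareWeight ha
  have hD₁ := hD.mono_set hsub₁
  have hD₂ := hD.mono_set hsub₂
  have habs : IntegrableOn (fun w => chiSquareWeight a w * |1 - w / ν|) (Set.Ioi 0) :=
    integrableOn_chiSquareWeight_mul (ν := ν) ha measurableSet_Ioi
      subset_rfl (by fun_prop) fun w _ => by simp
  have hsplit : ∀ {g : ℝ → ℝ}, IntegrableOn g (Set.Ioi 0) →
      ∫ w in Set.Ioi 0, g w = (∫ w in Set.Ioc 0 m, g w) + ∫ w in Set.Ioi m, g w := fun hg => by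
    rw [← Set.Ioc_union_Ioi_eq_Ioi hm0]
    exact setIntegral_union Set.Ioc_disjoint_Ioi_same measurableSet_Ioi
      (hg.mono_set hsub₁) (hg.mono_set hsub₂)
  have hlin : ∀ (b : ℝ) (k : ℝ → ℝ) (w : ℝ),
      σ / 2 * (chiSquareWeight a w * (b - (1 - w / ν) * k w)) =
      σ / 2 * (b * chiSquareWeight a w - chiSquareWeight a w * ((1 - w / ν) * k w)) :=
    fun b k w => by ring
  have hint₁ : IntegrableOn (fun w => σ / 2 * (chiSquareWeight a w *
      ((1 - Φ) - (1 - w / ν) * k₁ w))) (Set.Ioc 0 m) := by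
    simp only [hlin]
    exact ((hD₁.const_mul _).sub hi₁).const_mul _
  have hint₂ : IntegrableOn (fun w => σ / 2 * (chiSquareWeight a w *
      (-Φ - (1 - w / ν) * k₂ w))) (Set.Ioi m) := by
    simp only [hlin]
    exact ((hD₂.const_mul _).sub hi₂).const_mul _
  have hzero : chiSquareWeight (a + 1) 0 = 0 := by simp [chiSquareWeight, ha.ne']
  have hcont := continuous_chiSquareWeight_add_one ha
  have hF₁ : ∫ w in Set.Ioc 0 m, σ / 2 * (chiSquareWeight a w * ((1 - Φ) - (1 - w / ν) * k₁ w)) =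
      chiSquareWeight (a + 1) m * ((1 - Φ) * millsRatio (t m)) := by
    rw [← intervalIntegral.integral_of_le hm0,
      intervalIntegral.integral_eq_sub_of_hasDerivAt_of_le
        (f := fun w => chiSquareWeight (a + 1) w * ((1 - Φ) * millsRatio (t w))) hm0
        (by fun_prop) (fun w hw => ?_)
        ((intervalIntegrable_iff_integrableOn_Ioc_of_le hm0).2 hint₁)]
    · simp [hzero]
    · exact hasDerivAt_chiSquareWeight_mul_comp (f := fun x => (1 - Φ) * millsRatio x) hσ hσν hw.1
        ((hasDerivAt_millsRatio _).const_mul (1 - Φ)) (by ring)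
  have hN : ∀ x, HasDerivAt (fun x => Φ * millsRatio (-x))
      (-(Φ * (1 + -x * millsRatio (-x)))) x := fun x => by
    convert! ((hasDerivAt_millsRatio (-x)).comp x (hasDerivAt_neg x)).const_mul Φ using 1
    ring
  have htop : Tendsto (fun w => chiSquareWeight (a + 1) w * (Φ * millsRatio (-t w)))
      atTop (nhds 0) := by
    refine squeeze_zero' ?_ ?_ (tendsto_chiSquareWeight (a + 1))
    · filter_upwards [eventually_ge_atTop 0] with w hw
      exact mul_nonneg (chiSquareWeight_nonneg _ hw) (mul_nonneg hΦ0 (millsRatio_nonneg _))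
    · filter_upwards [eventually_ge_atTop 0, eventually_ge_atTop (2 * a + σ)] with w hw hw'
      have h1 : 1 ≤ t w := by
        rw [ht, le_div_iff₀ hσ]
        linarith
      have h2 := one_add_mul_millsRatio_nonneg (-t w)
      have h3 := millsRatio_nonneg (-t w)
      refine mul_le_of_le_one_right (chiSquareWeight_nonneg _ hw) ?_
      nlinarith
  have hF₂ : ∫ w in Set.Ioi m, σ / 2 * (chiSquareWeight a w * (-Φ - (1 - w / ν) * k₂ w)) =
      0 - chiSquareWeight (a + 1) m * (Φ * millsRatio (-t m)) :=
    integral_Ioi_of_hasDerivAt_of_tendsto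
      (f := fun w => chiSquareWeight (a + 1) w * (Φ * millsRatio (-t w)))
      (by fun_prop) (fun w hw => hasDerivAt_chiSquareWeight_mul_comp
        (f := fun x => Φ * millsRatio (-x)) hσ hσν (hsub₂ hw) (hN _) (by ring)) hint₂ htop
  have hmatch : chiSquareWeight (a + 1) m * ((1 - Φ) * millsRatio (t m)) =
      chiSquareWeight (a + 1) m * (Φ * millsRatio (-t m)) := by
    rcases le_total (2 * a + σ * z) 0 with h | h
    · simp [hm, max_eq_right h, hzero]
    · have htm : t m = z := by
        rw [ht, hm, max_eq_left h]
        field_simp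
        ring
      rw [htm, millsRatio, millsRatio, stdNormalCDF_neg, gaussianPDFReal_std_neg]
      ring
  simp only [hlin] at hF₁ hF₂
  rw [integral_const_mul, integral_sub (hD₁.const_mul _) hi₁, integral_const_mul] at hF₁
  rw [integral_const_mul, integral_sub (hD₂.const_mul _) hi₂, integral_const_mul] at hF₂
  have hstein : (∫ w in Set.Ioc 0 m, chiSquareWeight a w) -
      Φ * (∫ w in Set.Ioi 0, chiSquareWeight a w) =
      (∫ w in Set.Ioc 0 m, chiSquareWeight a w * ((1 - w / ν) * k₁ w)) +
        ∫ w in Set.Ioi m, chiSquareWeight a w * ((1 - w / ν) * k₂ w) := by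
    rw [hsplit hD]
    refine mul_left_cancel₀ (half_pos hσ).ne' ?_
    linarith
  have hbound : ∀ {s : Set ℝ} {k : ℝ → ℝ}, MeasurableSet s → s ⊆ Set.Ioi 0 →
      (∀ w ∈ s, |k w| ≤ 1) →
      |∫ w in s, chiSquareWeight a w * ((1 - w / ν) * k w)| ≤
        ∫ w in s, chiSquareWeight a w * |1 - w / ν| := by
    intro s k hs hs0 hk
    rw [← norm_eq_abs]
    refine norm_integral_le_of_norm_le (habs.mono_set hs0)
      ((ae_restrict_iff' hs).2 (ae_of_all _ fun w hw => ?_))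
    have hw0 := chiSquareWeight_nonneg a (le_of_lt (hs0 hw))
    rw [norm_mul, norm_eq_abs, norm_eq_abs, abs_of_nonneg hw0]
    exact mul_le_mul_of_nonneg_left (hprod (hk w hw)) hw0
  calc _ ≤ _ := by rw [hstein]; exact abs_add_le _ _
    _ ≤ (∫ w in Set.Ioc 0 m, chiSquareWeight a w * |1 - w / ν|) +
        ∫ w in Set.Ioi m, chiSquareWeight a w * |1 - w / ν| :=
      add_le_add (hbound measurableSet_Ioc hsub₁ hk₁b) (hbound measurableSet_Ioi hsub₂ hk₂b)
    _ = ∫ w in Set.Ioi 0, chiSquareWeight a w * |1 - w / ν| := (hsplit habs).symm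
    _ ≤ _ := integral_chiSquareWeight_mul_abs_le ha hc hc2

theorem gammaMeasure_half_Iic_toReal {a : ℝ} (ha : 0 < a) (x : ℝ) :
    (gammaMeasure a (1 / 2) (Set.Iic x)).toReal =
      (∫ w in Set.Ioc 0 (max x 0), chiSquareWeight a w) /
        ∫ w in Set.Ioi 0, chiSquareWeight a w := by
  have : IsProbabilityMeasure (gammaMeasure a (1 / 2)) :=
    isProbabilityMeasure_gammaMeasure ha (by norm_num)
  have hpdf : gammaPDFReal a (1 / 2) = (Set.Ici 0).indicator
      fun w => (1 / 2) ^ a / Gamma a * chiSquareWeight a w := by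
    ext w
    simp only [gammaPDFReal, Set.indicator_apply, Set.mem_Ici, chiSquareWeight, mul_assoc]
  have hset : (Set.Iic x ∩ Set.Ici 0 : Set ℝ) =ᵐ[volume] (Set.Ioc 0 (max x 0) : Set ℝ) := by
    rw [Set.inter_comm, Set.Ici_inter_Iic]
    rcases le_total x 0 with h | h
    · rw [max_eq_right h, Set.Ioc_self, ae_eq_empty]
      refine measure_mono_null (t := {0}) (fun y hy => ?_) (by simp)
      exact le_antisymm (hy.2.trans h) hy.1
    · rw [max_eq_left h]
      exact Ioc_ae_eq_Icc.symm
  change (gammaMeasure a (1 / 2)).real (Set.Iic x) = _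
  rw [← cdf_eq_real, cdf_gammaMeasure_eq_integral ha (by norm_num), hpdf,
    setIntegral_indicator measurableSet_Ici, setIntegral_congr_set hset, integral_const_mul,
    integral_chiSquareWeight ha, one_div, inv_rpow zero_le_two]
  ring

theorem berry_esseen_bound_chiSquare (n : ℕ) (hn : 2 ≤ n) :
    ∀ z : ℝ,
      |((gammaMeasure (((n : ℝ) - 1) / 2) (1 / 2))
          {w : ℝ | (w - ((n : ℝ) - 1)) / Real.sqrt (2 * n) ≤ z}).toReal
        - stdNormalCDF z| ≤ Real.sqrt (2 * n - 1) / n := by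
  intro z
  have hn' : (2 : ℝ) ≤ n := by exact_mod_cast hn
  have ha : 0 < ((n : ℝ) - 1) / 2 := by linarith
  have hσ : 0 < √(2 * (n : ℝ)) := sqrt_pos.2 (by linarith)
  have hc : 0 < √(2 * (n : ℝ) - 1) / n := div_pos (sqrt_pos.2 (by linarith)) (by linarith)
  have hset : {w : ℝ | (w - ((n : ℝ) - 1)) / √(2 * n) ≤ z} =
      Set.Iic (2 * (((n : ℝ) - 1) / 2) + √(2 * n) * z) := by
    ext w
    rw [Set.mem_ofPred_eq, Set.mem_Iic, div_le_iff₀ hσ, sub_le_iff_le_add]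
    ring_nf
  have h := abs_integral_chiSquareWeight_sub_le (ν := n) ha hσ (sq_sqrt (by linarith)) hc
    (by
      rw [div_pow, sq_sqrt (by linarith)]
      field_simp
      ring) z
  have hI : 0 < ∫ w in Set.Ioi 0, chiSquareWeight (((n : ℝ) - 1) / 2) w := by
    have := Gamma_pos_of_pos ha
    rw [integral_chiSquareWeight ha]
    positivity
  rw [hset, gammaMeasure_half_Iic_toReal ha, div_sub' hI.ne', abs_div, abs_of_pos hI,
    div_le_iff₀ hI, mul_comm _ (stdNormalCDF z)]
  exact h
end

section
/- For n ≥ 2, let W_n be a random variable with the chi-square distribution with n − 1 degrees of freedom and set Q̄_n = (W_n − (n − 1))/√(2n). Then for every fixed z ∈ ℝ, (n/√(2n − 1))·(P(Q̄_n ≤ z) − Φ(z)) → −Φ⁽³⁾(z)/3 as n → ∞, where Φ(z) = ∫_{−∞}^{z} (1/√(2π)) e^{−x²/2} dx and Φ⁽³⁾(z) = (z² − 1)(1/√(2π)) e^{−z²/2} is the third derivative of Φ. -/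
open MeasureTheory ProbabilityTheory Real Filter

open Topology Asymptotics

/-- With `ε = 1 / √a`, the unnormalised density of `√a * log (r * W / a)` for `W` distributed as
`gammaMeasure a r`. -/
noncomputable def logGammaKernel (ε y : ℝ) : ℝ :=
  Real.exp (-((Real.exp (ε * y) - 1 - ε * y) / ε ^ 2))

lemma continuous_logGammaKernel (ε : ℝ) : Continuous (logGammaKernel ε) := by
  unfold logGammaKernel
  fun_prop

lemma logGammaKernel_pos (ε y : ℝ) : 0 < logGammaKernel ε y := Real.exp_pos _

lemma one_sub_mul_le_exp {ε : ℝ} (hε1 : ε ≤ 1) (t : ℝ) :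
    (1 - ε) * (1 + ε + t) ≤ Real.exp t := by
  rcases le_total (1 + ε + t) 0 with h | h
  · exact (mul_nonpos_of_nonneg_of_nonpos (by linarith) h).trans (Real.exp_pos t).le
  · have h1 : 1 - ε ≤ Real.exp (-ε) := by linarith [Real.add_one_le_exp (-ε)]
    have h2 : 1 + ε + t ≤ Real.exp (ε + t) := by linarith [Real.add_one_le_exp (ε + t)]
    calc (1 - ε) * (1 + ε + t) ≤ Real.exp (-ε) * Real.exp (ε + t) := by gcongr
      _ = Real.exp t := by rw [← Real.exp_add]; congr 1; ring

lemma logGammaKernel_le_exp {ε : ℝ} (hε : 0 < ε) (hε1 : ε ≤ 1) (y : ℝ) :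
    logGammaKernel ε y ≤ Real.exp (1 + y) := by
  unfold logGammaKernel
  rw [Real.exp_le_exp, neg_le, le_div_iff₀ (by positivity)]
  nlinarith [one_sub_mul_le_exp hε1 (ε * y)]

lemma logGammaKernel_le_gaussian {ε y : ℝ} (hε : 0 < ε) (hy : 0 ≤ y) :
    logGammaKernel ε y ≤ Real.exp (-y ^ 2 / 2) := by
  unfold logGammaKernel
  rw [Real.exp_le_exp, neg_le, le_div_iff₀ (by positivity)]
  nlinarith [Real.quadratic_le_exp_of_nonneg (mul_nonneg hε.le hy)]

lemma abs_exp_sub_quadratic_le (t : ℝ) :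
    |Real.exp t - (1 + t + t ^ 2 / 2)| ≤ 3 * |t| ^ 3 * Real.exp (max t 0) := by
  rcases le_total 0 t with ht | ht
  · have h := Complex.norm_exp_sub_sum_le_norm_mul_exp (t : ℂ) 3
    have h2 : ‖Complex.exp t - ∑ m ∈ Finset.range 3, (t : ℂ) ^ m / m.factorial‖
        = |Real.exp t - (1 + t + t ^ 2 / 2)| := by
      rw [← Real.norm_eq_abs, ← Complex.norm_real]
      congr 1
      simp [Finset.sum_range_succ, Nat.factorial]
    rw [h2] at h
    simp only [Complex.norm_real, Real.norm_eq_abs] at h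
    rw [max_eq_left ht]
    have : 0 ≤ |t| ^ 3 * Real.exp t := by positivity
    rw [abs_of_nonneg ht] at h this ⊢
    linarith
  · rw [max_eq_right ht, Real.exp_zero, mul_one]
    rcases le_total |t| 1 with h1 | h1
    · have h := Real.exp_bound h1 (n := 3) (by norm_num)
      norm_num [Finset.sum_range_succ, Nat.factorial] at h
      have : 0 ≤ |t| ^ 3 := by positivity
      linarith
    · have h0 := Real.exp_pos t
      have h2 := Real.exp_le_one_iff.2 ht
      rw [abs_of_nonpos ht] at *
      rw [abs_le]
      have h4 : 0 ≤ (-t - 1) ^ 2 * (-t) := by nlinarith [sq_nonneg (-t - 1)]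
      have h5 : 0 ≤ (-t - 1) * (-t) ^ 2 := by nlinarith [sq_nonneg t]
      have h6 : 0 ≤ (-t - 1) * (-t) := by nlinarith
      constructor <;> nlinarith

lemma abs_exp_sub_exp_le {A B M : ℝ} (hA : Real.exp A ≤ M) (hB : Real.exp B ≤ M) :
    |Real.exp A - Real.exp B| ≤ M * |A - B| := by
  wlog h : B ≤ A generalizing A B
  · rw [abs_sub_comm, abs_sub_comm A]
    exact this hB hA (le_of_not_ge h)
  rw [abs_of_nonneg (by simpa using h), abs_of_nonneg (by simpa using h)]
  have h1 : Real.exp B = Real.exp A * Real.exp (B - A) := by rw [← Real.exp_add]; ring_nf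
  have h2 := Real.add_one_le_exp (B - A)
  calc Real.exp A - Real.exp B ≤ Real.exp A * (A - B) := by
        rw [h1]; nlinarith [Real.exp_pos A]
    _ ≤ M * (A - B) := by gcongr

lemma gaussian_le_exp (y : ℝ) : Real.exp (-y ^ 2 / 2) ≤ Real.exp (1 + y) := by
  rw [Real.exp_le_exp]
  nlinarith [sq_nonneg (y + 1)]

lemma abs_logGammaKernel_sub_gaussian_le {ε : ℝ} (hε : 0 < ε) (hε1 : ε ≤ 1) (y : ℝ) :
    |(logGammaKernel ε y - Real.exp (-y ^ 2 / 2)) / ε| ≤ 3 * |y| ^ 3 * Real.exp (2 - |y|) := by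
  have key : ∀ M, logGammaKernel ε y ≤ M → Real.exp (-y ^ 2 / 2) ≤ M →
      |(logGammaKernel ε y - Real.exp (-y ^ 2 / 2)) / ε| ≤
        M * (3 * |y| ^ 3 * Real.exp (max y 0)) := by
    intro M h1 h2
    have hM : 0 ≤ M := (Real.exp_pos _).le.trans h2
    have h3 := abs_exp_sub_exp_le h1 h2
    have h4 : -((Real.exp (ε * y) - 1 - ε * y) / ε ^ 2) - -y ^ 2 / 2
        = -(Real.exp (ε * y) - (1 + ε * y + (ε * y) ^ 2 / 2)) / ε ^ 2 := by
      field_simp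
      ring
    have h5 := abs_exp_sub_quadratic_le (ε * y)
    have h6 : max (ε * y) 0 ≤ max y 0 := by
      refine max_le ?_ (le_max_right _ _)
      rcases le_total 0 y with hy | hy
      · exact (mul_le_of_le_one_left hy hε1).trans (le_max_left _ _)
      · exact (mul_nonpos_of_nonneg_of_nonpos hε.le hy).trans (le_max_right _ _)
    rw [abs_div, abs_of_pos hε, div_le_iff₀ hε]
    refine h3.trans ?_
    rw [h4, abs_div, abs_neg, abs_of_pos (by positivity : 0 < ε ^ 2), mul_assoc]
    gcongr
    rw [div_le_iff₀ (by positivity)]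
    refine h5.trans ?_
    rw [abs_mul, abs_of_pos hε]
    calc 3 * (ε * |y|) ^ 3 * Real.exp (max (ε * y) 0)
        ≤ 3 * (ε * |y|) ^ 3 * Real.exp (max y 0) := by gcongr
      _ = 3 * |y| ^ 3 * Real.exp (max y 0) * ε * ε ^ 2 := by ring
  have comb : ∀ s t : ℝ, s + t ≤ 2 - |y| →
      Real.exp s * (3 * |y| ^ 3 * Real.exp t) ≤ 3 * |y| ^ 3 * Real.exp (2 - |y|) := by
    intro s t hst
    calc Real.exp s * (3 * |y| ^ 3 * Real.exp t) = 3 * |y| ^ 3 * Real.exp (s + t) := by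
          rw [Real.exp_add]; ring
      _ ≤ _ := by gcongr
  rcases le_total 0 y with hy | hy
  · refine (key _ (logGammaKernel_le_gaussian hε hy) le_rfl).trans (comb _ _ ?_)
    rw [max_eq_left hy, abs_of_nonneg hy]
    nlinarith [sq_nonneg (y - 2)]
  · refine (key _ (logGammaKernel_le_exp hε hε1 y) (gaussian_le_exp y)).trans (comb _ _ ?_)
    rw [max_eq_right hy, abs_of_nonpos hy]
    linarith

lemma integrable_abs_pow_three_mul_exp (c : ℝ) :
    Integrable fun y : ℝ => 3 * |y| ^ 3 * Real.exp (c - |y|) := by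
  refine (integrable_inv_one_add_sq.const_mul (378 * Real.exp c)).mono'
    (by fun_prop) (ae_of_all _ fun y => ?_)
  rw [Real.norm_of_nonneg (by positivity), Real.exp_sub, ← div_eq_mul_inv, mul_div_assoc',
    div_le_div_iff₀ (Real.exp_pos _) (by positivity), ← sq_abs y]
  have h1 := Real.pow_div_factorial_le_exp |y| (abs_nonneg y) 3
  have h2 := Real.pow_div_factorial_le_exp |y| (abs_nonneg y) 5
  norm_num [Nat.factorial] at h1 h2
  nlinarith [Real.exp_pos c]

lemma integrable_gaussian : Integrable fun y : ℝ => Real.exp (-y ^ 2 / 2) := by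
  refine (integrable_exp_neg_mul_sq (b := 1 / 2) (by norm_num)).congr (ae_of_all _ fun y => ?_)
  simp only
  congr 1
  ring

lemma integrable_logGammaKernel {ε : ℝ} (hε : 0 < ε) (hε1 : ε ≤ 1) :
    Integrable (logGammaKernel ε) := by
  have hg := continuous_logGammaKernel ε
  have h : Integrable fun y => (logGammaKernel ε y - Real.exp (-y ^ 2 / 2)) / ε :=
    (integrable_abs_pow_three_mul_exp 2).mono' (by fun_prop)
      (ae_of_all _ (abs_logGammaKernel_sub_gaussian_le hε hε1))
  refine ((h.const_mul ε).add integrable_gaussian).congr (ae_of_all _ fun y => ?_)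
  simp only [Pi.add_apply]
  field_simp
  ring

/-- A first-order chain rule along a filter. -/
lemma HasDerivAt.tendsto_sub_div {f : ℝ → ℝ} {f' B L : ℝ} (hf : HasDerivAt f f' B)
    {A : ℝ → ℝ} (hA : Tendsto (fun ε => (A ε - B) / ε) (𝓝[>] 0) (𝓝 L)) :
    Tendsto (fun ε => (f (A ε) - f B) / ε) (𝓝[>] 0) (𝓝 (f' * L)) := by
  have hε : Tendsto (fun ε : ℝ => ε) (𝓝[>] 0) (𝓝 0) := tendsto_id.mono_left nhdsWithin_le_nhds
  have hAB : Tendsto A (𝓝[>] 0) (𝓝 B) := by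
    have h := ((hA.mul hε).add_const B)
    rw [mul_zero, zero_add] at h
    refine h.congr' ?_
    filter_upwards [self_mem_nhdsWithin] with ε (h : 0 < ε)
    field_simp
    ring
  have hO : (fun ε => A ε - B) =O[𝓝[>] 0] fun ε : ℝ => ε := by
    refine isBigO_of_div_tendsto_nhds ?_ L hA
    filter_upwards [self_mem_nhdsWithin] with ε (h : 0 < ε) h0
    exact absurd h0 h.ne'
  have ho := ((hf.isLittleO.comp_tendsto hAB).trans_isBigO hO).tendsto_div_nhds_zero
  have h := ho.add (hA.const_mul f')
  rw [zero_add] at h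
  refine h.congr fun ε => ?_
  simp only [Function.comp, smul_eq_mul]
  ring

lemma tendsto_exp_sub_quadratic_div (y : ℝ) :
    Tendsto (fun ε => (-((Real.exp (ε * y) - 1 - ε * y) / ε ^ 2) - -y ^ 2 / 2) / ε)
      (𝓝[>] 0) (𝓝 (-(y ^ 3 / 6))) := by
  have hε : Tendsto (fun ε : ℝ => ε) (𝓝[>] 0) (𝓝 0) := tendsto_id.mono_left nhdsWithin_le_nhds
  have hb : ∀ᶠ ε : ℝ in 𝓝[>] 0, |ε * y| ≤ 1 := by
    have h : Tendsto (fun ε : ℝ => |ε * y|) (𝓝[>] 0) (𝓝 0) := by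
      simpa using (hε.mul_const y).abs
    exact h.eventually_le_const one_pos
  rw [tendsto_iff_norm_sub_tendsto_zero]
  refine squeeze_zero' (g := fun ε => y ^ 4 * ε) (Eventually.of_forall fun _ => norm_nonneg _) ?_
    (by simpa using hε.const_mul (y ^ 4))
  filter_upwards [self_mem_nhdsWithin, hb] with ε (hpos : 0 < ε) h1
  have h := Real.exp_bound h1 (n := 4) (by norm_num)
  norm_num [Finset.sum_range_succ, Nat.factorial] at h
  have e : (-((Real.exp (ε * y) - 1 - ε * y) / ε ^ 2) - -y ^ 2 / 2) / ε - -(y ^ 3 / 6)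
      = -(Real.exp (ε * y) - (1 + ε * y + (ε * y) ^ 2 / 2 + (ε * y) ^ 3 / 6)) / ε ^ 3 := by
    field_simp
    ring
  rw [e, Real.norm_eq_abs, abs_div, abs_neg, abs_of_pos (by positivity : 0 < ε ^ 3),
    div_le_iff₀ (by positivity)]
  refine h.trans ?_
  rw [← abs_mul, Even.pow_abs (by decide)]
  have : 0 ≤ (ε * y) ^ 4 := by positivity
  nlinarith

lemma tendsto_logGammaKernel_sub_gaussian_div (y : ℝ) :
    Tendsto (fun ε => (logGammaKernel ε y - Real.exp (-y ^ 2 / 2)) / ε) (𝓝[>] 0)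
      (𝓝 (-(y ^ 3 / 6) * Real.exp (-y ^ 2 / 2))) := by
  rw [mul_comm]
  exact (Real.hasDerivAt_exp _).tendsto_sub_div (tendsto_exp_sub_quadratic_div y)

lemma tendsto_setIntegral_logGammaKernel_sub_div {s : ℝ → Set ℝ} {s₀ : Set ℝ}
    (hs : ∀ ε, MeasurableSet (s ε)) (hs₀ : MeasurableSet s₀)
    (h : ∀ᵐ y, ∀ᶠ ε in 𝓝[>] 0, (y ∈ s ε ↔ y ∈ s₀)) :
    Tendsto (fun ε => ((∫ y in s ε, logGammaKernel ε y) - ∫ y in s ε, Real.exp (-y ^ 2 / 2)) / ε)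
      (𝓝[>] 0) (𝓝 (∫ y in s₀, -(y ^ 3 / 6) * Real.exp (-y ^ 2 / 2))) := by
  have hpos : ∀ᶠ ε : ℝ in 𝓝[>] 0, 0 < ε ∧ ε ≤ 1 := Ioc_mem_nhdsGT one_pos
  rw [← integral_indicator hs₀]
  have hlim := tendsto_integral_filter_of_dominated_convergence (μ := volume) (l := 𝓝[>] (0 : ℝ))
    (F := fun ε => (s ε).indicator fun y => (logGammaKernel ε y - Real.exp (-y ^ 2 / 2)) / ε)
    (f := s₀.indicator fun y => -(y ^ 3 / 6) * Real.exp (-y ^ 2 / 2))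
    (fun y => 3 * |y| ^ 3 * Real.exp (2 - |y|)) ?_ ?_ (integrable_abs_pow_three_mul_exp 2) ?_
  · refine hlim.congr' ?_
    filter_upwards [hpos] with ε hε
    rw [integral_indicator (hs ε), integral_div, integral_sub]
    · exact (integrable_logGammaKernel hε.1 hε.2).integrableOn
    · exact integrable_gaussian.integrableOn
  · refine Eventually.of_forall fun ε => ?_
    have hg := continuous_logGammaKernel ε
    exact AEStronglyMeasurable.indicator (by fun_prop) (hs ε)
  · filter_upwards [hpos] with ε hε
    refine ae_of_all _ fun y => (norm_indicator_le_norm_self _ _).trans ?_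
    exact abs_logGammaKernel_sub_gaussian_le hε.1 hε.2 y
  · filter_upwards [h] with y hy
    by_cases hy₀ : y ∈ s₀
    · rw [Set.indicator_of_mem hy₀]
      refine (tendsto_logGammaKernel_sub_gaussian_div y).congr' ?_
      filter_upwards [hy] with ε hε
      rw [Set.indicator_of_mem (hε.2 hy₀)]
    · rw [Set.indicator_of_notMem hy₀]
      refine tendsto_const_nhds.congr' ?_
      filter_upwards [hy] with ε hε
      rw [Set.indicator_of_notMem (mt hε.1 hy₀)]

lemma hasDerivAt_gaussian_antideriv (y : ℝ) :
    HasDerivAt (fun y : ℝ => (y ^ 2 + 2) / 6 * Real.exp (-y ^ 2 / 2))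
      (-(y ^ 3 / 6) * Real.exp (-y ^ 2 / 2)) y := by
  have h1 : HasDerivAt (fun y : ℝ => (y ^ 2 + 2) / 6) (2 * y / 6) y := by
    simpa using ((hasDerivAt_pow 2 y).add_const 2).div_const 6
  have h2 : HasDerivAt (fun y : ℝ => -y ^ 2 / 2) (-y) y := by
    have h := (hasDerivAt_pow 2 y).neg.div_const 2
    refine h.congr_deriv ?_
    norm_num
    ring
  refine (h1.mul h2.exp).congr_deriv ?_
  ring

lemma tendsto_gaussian_antideriv {l : Filter ℝ} (hl : Tendsto (fun y : ℝ => y ^ 2) l atTop) :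
    Tendsto (fun y : ℝ => (y ^ 2 + 2) / 6 * Real.exp (-y ^ 2 / 2)) l (𝓝 0) := by
  have h := ((Real.tendsto_pow_mul_exp_neg_atTop_nhds_zero 1).add
    (Real.tendsto_pow_mul_exp_neg_atTop_nhds_zero 0)).comp (hl.atTop_div_const two_pos)
  have h' := h.const_mul (1 / 3)
  rw [add_zero, mul_zero] at h'
  refine h'.congr fun y => ?_
  simp only [Function.comp, neg_div]
  ring

lemma integrable_cube_mul_gaussian :
    Integrable fun y : ℝ => -(y ^ 3 / 6) * Real.exp (-y ^ 2 / 2) := by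
  refine (integrable_abs_pow_three_mul_exp 1).mono' (by fun_prop) (ae_of_all _ fun y => ?_)
  rw [norm_mul, Real.norm_eq_abs, Real.norm_eq_abs, Real.abs_exp, abs_neg, abs_div, abs_pow]
  have h : Real.exp (-y ^ 2 / 2) ≤ Real.exp (1 - |y|) := by
    rw [Real.exp_le_exp, ← sq_abs]
    nlinarith [sq_nonneg (|y| - 1)]
  have h3 : |y| ^ 3 / |6| ≤ 3 * |y| ^ 3 := by
    have : 0 ≤ |y| ^ 3 := by positivity
    norm_num
    linarith
  gcongr

lemma tendsto_sq_atBot_atTop : Tendsto (fun y : ℝ => y ^ 2) atBot atTop :=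
  ((tendsto_pow_atTop two_ne_zero).comp tendsto_abs_atBot_atTop).congr sq_abs

lemma setIntegral_Iic_cube_mul_gaussian (z : ℝ) :
    ∫ y in Set.Iic z, -(y ^ 3 / 6) * Real.exp (-y ^ 2 / 2) =
      (z ^ 2 + 2) / 6 * Real.exp (-z ^ 2 / 2) := by
  rw [integral_Iic_of_hasDerivAt_of_tendsto' (fun y _ => hasDerivAt_gaussian_antideriv y)
    integrable_cube_mul_gaussian.integrableOn (m := 0), sub_zero]
  exact tendsto_gaussian_antideriv tendsto_sq_atBot_atTop

lemma integral_cube_mul_gaussian :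
    ∫ y : ℝ, -(y ^ 3 / 6) * Real.exp (-y ^ 2 / 2) = 0 := by
  rw [integral_of_hasDerivAt_of_tendsto hasDerivAt_gaussian_antideriv
    integrable_cube_mul_gaussian (m := 0) (n := 0), sub_zero]
  · exact tendsto_gaussian_antideriv tendsto_sq_atBot_atTop
  · exact tendsto_gaussian_antideriv (tendsto_pow_atTop two_ne_zero)

lemma hasDerivAt_setIntegral_Iic_gaussian (z : ℝ) :
    HasDerivAt (fun c => ∫ y in Set.Iic c, Real.exp (-y ^ 2 / 2)) (Real.exp (-z ^ 2 / 2)) z := by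
  have hcont : Continuous fun y : ℝ => Real.exp (-y ^ 2 / 2) := by fun_prop
  have h := (hcont.integral_hasStrictDerivAt 0 z).hasDerivAt.const_add
    (∫ y in Set.Iic 0, Real.exp (-y ^ 2 / 2))
  refine h.congr_of_eventuallyEq (Eventually.of_forall fun c => ?_)
  simp only
  rw [← intervalIntegral.integral_Iic_sub_Iic integrable_gaussian.integrableOn
    integrable_gaussian.integrableOn]
  ring

lemma gammaMeasure_image {ε r : ℝ} (hε : 0 < ε) (hr : 0 < r) {s : Set ℝ} (hs : MeasurableSet s) :
    gammaMeasure (ε ^ 2)⁻¹ r ((fun y => (ε ^ 2)⁻¹ / r * Real.exp (ε * y)) '' s) =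
      ENNReal.ofReal (r ^ (ε ^ 2)⁻¹ / Real.Gamma (ε ^ 2)⁻¹ * ((ε ^ 2)⁻¹ / r) ^ (ε ^ 2)⁻¹ * ε *
        Real.exp (-(ε ^ 2)⁻¹)) * ∫⁻ y in s, ENNReal.ofReal (logGammaKernel ε y) := by
  have ha : (0 : ℝ) < (ε ^ 2)⁻¹ := by positivity
  have hker : ∀ y, logGammaKernel ε y =
      Real.exp (-((ε ^ 2)⁻¹ * (Real.exp (ε * y) - 1 - ε * y))) := fun y => by
    rw [logGammaKernel, div_eq_inv_mul]
  have hΓ := Real.Gamma_pos_of_pos ha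
  simp only [hker]
  generalize (ε ^ 2)⁻¹ = a at ha hΓ ⊢
  have hderiv : ∀ y, HasDerivAt (fun y => a / r * Real.exp (ε * y))
      (a / r * (Real.exp (ε * y) * ε)) y := fun y => by
    simpa using ((hasDerivAt_id y).const_mul ε).exp.const_mul (a / r)
  have hinj : Function.Injective fun y => a / r * Real.exp (ε * y) := by
    intro x y hxy
    exact mul_left_cancel₀ hε.ne'
      (Real.exp_injective (mul_left_cancel₀ (div_pos ha hr).ne' hxy))
  have himage : MeasurableSet ((fun y => a / r * Real.exp (ε * y)) '' s) :=
    hs.image_of_continuousOn_injOn (by fun_prop) hinj.injOn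
  rw [gammaMeasure, withDensity_apply _ himage, lintegral_image_eq_lintegral_abs_deriv_mul hs
    (fun y _ => (hderiv y).hasDerivWithinAt) hinj.injOn,
    ← lintegral_const_mul' _ _ ENNReal.ofReal_ne_top]
  refine lintegral_congr fun y => ?_
  have hpos : 0 < a / r * Real.exp (ε * y) := by positivity
  rw [gammaPDF_of_nonneg hpos.le, ← ENNReal.ofReal_mul (abs_nonneg _),
    ← ENNReal.ofReal_mul (by positivity), abs_of_pos (by positivity), Real.rpow_sub_one hpos.ne',
    Real.mul_rpow (by positivity) (by positivity), ← Real.exp_mul]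
  congr 1
  have e : Real.exp (-a) * Real.exp (-(a * (Real.exp (ε * y) - 1 - ε * y))) =
      Real.exp (ε * y * a) * Real.exp (-(r * (a / r * Real.exp (ε * y)))) := by
    rw [← Real.exp_add, ← Real.exp_add]
    congr 1
    field_simp
    ring
  rw [mul_assoc _ (Real.exp (-a)), e]
  field_simp

lemma gammaMeasure_Iic_zero (a r : ℝ) : gammaMeasure a r (Set.Iic 0) = 0 := by
  rw [gammaMeasure, withDensity_apply _ measurableSet_Iic, ← setLIntegral_congr Iio_ae_eq_Iic]
  exact lintegral_gammaPDF_of_nonpos le_rfl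

lemma gammaMeasure_inter_Ioi_zero (a r : ℝ) (s : Set ℝ) :
    gammaMeasure a r (s ∩ Set.Ioi 0) = gammaMeasure a r s := by
  rw [← Set.compl_Iic, ← Set.sdiff_eq]
  exact measure_sdiff_null (gammaMeasure_Iic_zero a r)

lemma range_const_mul_exp {ε k : ℝ} (hε : 0 < ε) (hk : 0 < k) :
    Set.range (fun y => k * Real.exp (ε * y)) = Set.Ioi 0 := by
  ext w
  constructor
  · rintro ⟨y, rfl⟩
    exact mul_pos hk (Real.exp_pos _)
  · intro (hw : 0 < w)
    refine ⟨Real.log (w / k) / ε, ?_⟩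
    simp only
    rw [mul_div_cancel₀ _ hε.ne', Real.exp_log (by positivity), mul_div_cancel₀ _ hk.ne']

lemma toReal_gammaMeasure_Iic {ε r : ℝ} (hε : 0 < ε) (hε1 : ε ≤ 1) (hr : 0 < r) (c : ℝ) :
    (gammaMeasure (ε ^ 2)⁻¹ r (Set.Iic ((ε ^ 2)⁻¹ / r * Real.exp (ε * c)))).toReal =
      (∫ y in Set.Iic c, logGammaKernel ε y) / ∫ y, logGammaKernel ε y := by
  have hk : 0 < (ε ^ 2)⁻¹ / r := by positivity
  have hint := integrable_logGammaKernel hε hε1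
  have hreal : ∀ s : Set ℝ, (∫⁻ y in s, ENNReal.ofReal (logGammaKernel ε y)).toReal =
      ∫ y in s, logGammaKernel ε y := fun s =>
    (integral_eq_lintegral_of_nonneg_ae (ae_of_all _ fun y => (logGammaKernel_pos ε y).le)
      hint.integrableOn.aestronglyMeasurable).symm
  have hK : 0 < r ^ (ε ^ 2)⁻¹ / Real.Gamma (ε ^ 2)⁻¹ * ((ε ^ 2)⁻¹ / r) ^ (ε ^ 2)⁻¹ * ε *
      Real.exp (-(ε ^ 2)⁻¹) := by
    have := Real.Gamma_pos_of_pos (by positivity : (0 : ℝ) < (ε ^ 2)⁻¹)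
    positivity
  have himage : (fun y => (ε ^ 2)⁻¹ / r * Real.exp (ε * y)) '' Set.Iic c =
      Set.Iic ((ε ^ 2)⁻¹ / r * Real.exp (ε * c)) ∩ Set.Ioi 0 := by
    rw [← range_const_mul_exp hε hk, ← Set.image_preimage_eq_inter_range]
    congr 1
    ext y
    simp [mul_le_mul_iff_right₀ hk, mul_le_mul_iff_right₀ hε]
  have := isProbabilityMeasure_gammaMeasure (by positivity : (0 : ℝ) < (ε ^ 2)⁻¹) hr
  have h1 := congrArg ENNReal.toReal (gammaMeasure_image hε hr (measurableSet_Iic (a := c)))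
  have h2 := congrArg ENNReal.toReal (gammaMeasure_image hε hr MeasurableSet.univ)
  rw [himage, gammaMeasure_inter_Ioi_zero, ENNReal.toReal_mul, ENNReal.toReal_ofReal hK.le,
    hreal] at h1
  rw [Set.image_univ, range_const_mul_exp hε hk, ← Set.univ_inter (Set.Ioi _),
    gammaMeasure_inter_Ioi_zero, measure_univ, ENNReal.toReal_one, ENNReal.toReal_mul,
    ENNReal.toReal_ofReal hK.le, hreal, setIntegral_univ] at h2
  rw [h1, eq_div_iff (by rintro h; simp [h] at h2), mul_right_comm, ← h2, one_mul]

lemma tendsto_log_one_add_sub_div (z : ℝ) :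
    Tendsto (fun ε => (Real.log (1 + z * ε * √(1 + ε ^ 2 / 2)) / ε - z) / ε) (𝓝[>] 0)
      (𝓝 (-(z ^ 2 / 2))) := by
  have hε : Tendsto (fun ε : ℝ => ε) (𝓝[>] 0) (𝓝 0) := tendsto_id.mono_left nhdsWithin_le_nhds
  have hsqrt : Tendsto (fun ε : ℝ => (√(1 + ε ^ 2 / 2) - 1) / ε) (𝓝[>] 0) (𝓝 0) := by
    have hd : HasDerivAt Real.sqrt (1 / (2 * √1)) 1 := Real.hasDerivAt_sqrt one_ne_zero
    have h := hd.tendsto_sub_div (A := fun ε => 1 + ε ^ 2 / 2) (L := 0) (by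
      have := hε.div_const 2
      rw [zero_div] at this
      refine this.congr' ?_
      filter_upwards [self_mem_nhdsWithin] with ε (h : 0 < ε)
      field_simp
      ring)
    simpa using h
  have hroot : Tendsto (fun ε : ℝ => √(1 + ε ^ 2 / 2)) (𝓝[>] 0) (𝓝 1) := by
    have : Continuous fun ε : ℝ => √(1 + ε ^ 2 / 2) := by fun_prop
    simpa using this.tendsto 0 |>.mono_left nhdsWithin_le_nhds
  have hs : Tendsto (fun ε : ℝ => |z * ε * √(1 + ε ^ 2 / 2)|) (𝓝[>] 0) (𝓝 0) := by
    simpa using ((hε.const_mul z).mul hroot).abs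
  have hrem : Tendsto (fun ε : ℝ => (Real.log (1 + z * ε * √(1 + ε ^ 2 / 2)) -
      (z * ε * √(1 + ε ^ 2 / 2) - (z * ε * √(1 + ε ^ 2 / 2)) ^ 2 / 2)) / ε ^ 2)
      (𝓝[>] 0) (𝓝 0) := by
    rw [tendsto_zero_iff_norm_tendsto_zero]
    refine squeeze_zero' (g := fun ε => 2 * (|z| * √(1 + ε ^ 2 / 2)) ^ 3 * ε)
      (Eventually.of_forall fun _ => norm_nonneg _) ?_
      (by simpa using (((hroot.const_mul |z|).pow 3).const_mul 2).mul hε)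
    filter_upwards [self_mem_nhdsWithin, hs.eventually_le_const (by norm_num : (0 : ℝ) < 1 / 2)]
      with ε (hpos : 0 < ε) hhalf
    have h := Real.abs_log_sub_add_sum_range_le (x := -(z * ε * √(1 + ε ^ 2 / 2)))
      (by rw [abs_neg]; linarith) 2
    have habs : |z * ε * √(1 + ε ^ 2 / 2)| = |z| * ε * √(1 + ε ^ 2 / 2) := by
      rw [abs_mul, abs_mul, abs_of_pos hpos, abs_of_nonneg (Real.sqrt_nonneg _)]
    norm_num [Finset.sum_range_succ] at h
    rw [Real.norm_eq_abs, abs_div, abs_of_pos (by positivity : 0 < ε ^ 2),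
      div_le_iff₀ (by positivity)]
    have h3 : |z * ε * √(1 + ε ^ 2 / 2)| ^ 3 / (1 - |z * ε * √(1 + ε ^ 2 / 2)|) ≤
        2 * |z * ε * √(1 + ε ^ 2 / 2)| ^ 3 := by
      rw [div_le_iff₀ (by linarith)]
      have : 0 ≤ |z * ε * √(1 + ε ^ 2 / 2)| ^ 3 := by positivity
      nlinarith
    calc _ ≤ 2 * |z * ε * √(1 + ε ^ 2 / 2)| ^ 3 := by
          refine le_trans (le_of_eq ?_) (h.trans (by simpa only [abs_mul] using h3))
          congr 1
          ring
      _ = _ := by rw [habs]; ring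
  have h := (hrem.add (hsqrt.const_mul z)).sub (((hroot.const_mul z).pow 2).div_const 2)
  simp only [mul_one, mul_zero, add_zero, zero_sub] at h
  refine h.congr' ?_
  filter_upwards [self_mem_nhdsWithin] with ε (hpos : 0 < ε)
  field_simp
  ring

lemma tendsto_setIntegral_Iic_logGammaKernel_sub_div {c : ℝ → ℝ} {z d : ℝ}
    (hc : Tendsto (fun ε => (c ε - z) / ε) (𝓝[>] 0) (𝓝 d)) :
    Tendsto (fun ε => ((∫ y in Set.Iic (c ε), logGammaKernel ε y) -
      ∫ y in Set.Iic z, Real.exp (-y ^ 2 / 2)) / ε) (𝓝[>] 0)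
      (𝓝 (((z ^ 2 + 2) / 6 + d) * Real.exp (-z ^ 2 / 2))) := by
  have hε : Tendsto (fun ε : ℝ => ε) (𝓝[>] 0) (𝓝 0) := tendsto_id.mono_left nhdsWithin_le_nhds
  have hcz : Tendsto c (𝓝[>] 0) (𝓝 z) := by
    have h := (hc.mul hε).add_const z
    rw [mul_zero, zero_add] at h
    refine h.congr' ?_
    filter_upwards [self_mem_nhdsWithin] with ε (h : 0 < ε)
    field_simp
    ring
  have h1 := tendsto_setIntegral_logGammaKernel_sub_div (s := fun ε => Set.Iic (c ε))
    (s₀ := Set.Iic z) (fun _ => measurableSet_Iic) measurableSet_Iic (by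
      filter_upwards [Measure.ae_ne volume z] with y hy
      rcases lt_or_gt_of_ne hy with h | h
      · filter_upwards [hcz.eventually_const_lt h] with ε hε
        simp [hε.le, h.le]
      · filter_upwards [hcz.eventually_lt_const h] with ε hε
        simp [not_le.2 hε, not_le.2 h])
  have h2 := (hasDerivAt_setIntegral_Iic_gaussian z).tendsto_sub_div hc
  rw [setIntegral_Iic_cube_mul_gaussian] at h1
  convert h1.add h2 using 2 <;> ring

lemma tendsto_integral_logGammaKernel_sub_div :
    Tendsto (fun ε => ((∫ y, logGammaKernel ε y) - √(2 * π)) / ε) (𝓝[>] 0) (𝓝 0) := by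
  have h := tendsto_setIntegral_logGammaKernel_sub_div (s := fun _ => Set.univ)
    (s₀ := Set.univ) (fun _ => MeasurableSet.univ) MeasurableSet.univ (by simp)
  simp only [setIntegral_univ, integral_cube_mul_gaussian] at h
  have hg : ∫ y : ℝ, Real.exp (-y ^ 2 / 2) = √(2 * π) := by
    rw [show 2 * π = π / (1 / 2) by ring, ← integral_gaussian]
    congr 1 with y
    congr 1
    ring
  rwa [hg] at h

lemma tendsto_gammaMeasure_sub_stdNormalCDF_div (z : ℝ) :
    Tendsto (fun ε => ((gammaMeasure (ε ^ 2)⁻¹ (1 / 2)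
        (Set.Iic ((ε ^ 2)⁻¹ / (1 / 2) * (1 + z * ε * √(1 + ε ^ 2 / 2))))).toReal -
          stdNormalCDF z) / ε) (𝓝[>] 0)
      (𝓝 (-((z ^ 2 - 1) * (1 / √(2 * π)) * Real.exp (-z ^ 2 / 2)) / 3)) := by
  have hε : Tendsto (fun ε : ℝ => ε) (𝓝[>] 0) (𝓝 0) := tendsto_id.mono_left nhdsWithin_le_nhds
  have hnum := tendsto_setIntegral_Iic_logGammaKernel_sub_div (tendsto_log_one_add_sub_div z)
  have hden := tendsto_integral_logGammaKernel_sub_div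
  have h2π : 0 < √(2 * π) := by positivity
  have hlim : Tendsto (fun ε => ∫ y, logGammaKernel ε y) (𝓝[>] 0) (𝓝 √(2 * π)) := by
    have h := (hden.mul hε).add_const √(2 * π)
    rw [mul_zero, zero_add] at h
    refine h.congr' ?_
    filter_upwards [self_mem_nhdsWithin] with ε (h : 0 < ε)
    field_simp
    ring
  have hpos : ∀ᶠ ε : ℝ in 𝓝[>] 0, 0 < 1 + z * ε * √(1 + ε ^ 2 / 2) := by
    have hc : Continuous fun ε : ℝ => 1 + z * ε * √(1 + ε ^ 2 / 2) := by fun_prop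
    exact ((hc.tendsto 0).mono_left nhdsWithin_le_nhds).eventually_const_lt (by simp)
  have h := (hnum.sub (hden.const_mul (stdNormalCDF z))).div hlim h2π.ne'
  have hval : (((z ^ 2 + 2) / 6 + -(z ^ 2 / 2)) * Real.exp (-z ^ 2 / 2) -
      stdNormalCDF z * 0) / √(2 * π) =
      -((z ^ 2 - 1) * (1 / √(2 * π)) * Real.exp (-z ^ 2 / 2)) / 3 := by
    field_simp
    ring
  rw [hval] at h
  refine h.congr' ?_
  filter_upwards [Ioc_mem_nhdsGT one_pos, hpos, hlim.eventually_const_lt h2π]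
    with ε hε hpos hI
  have hm := toReal_gammaMeasure_Iic hε.1 hε.2 (by norm_num : (0 : ℝ) < 1 / 2)
    (Real.log (1 + z * ε * √(1 + ε ^ 2 / 2)) / ε)
  rw [mul_div_cancel₀ _ hε.1.ne', Real.exp_log hpos] at hm
  have hΦ : ∫ y in Set.Iic z, Real.exp (-y ^ 2 / 2) = stdNormalCDF z * √(2 * π) := by
    rw [stdNormalCDF, integral_const_mul]
    field_simp
  have hε0 := hε.1
  simp only [Pi.div_apply]
  rw [hm, hΦ]
  field_simp
  ring

theorem edgeworth_limit_chiSquare (z : ℝ) :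
    Tendsto (fun n : ℕ =>
        ((n : ℝ) / Real.sqrt (2 * n - 1)) *
          (((gammaMeasure (((n : ℝ) - 1) / 2) (1 / 2))
              {w : ℝ | (w - ((n : ℝ) - 1)) / Real.sqrt (2 * n) ≤ z}).toReal
            - stdNormalCDF z))
      atTop
      (nhds (-((z ^ 2 - 1) * (1 / Real.sqrt (2 * Real.pi)) *
        Real.exp (-z ^ 2 / 2)) / 3)) := by
  have hn : Tendsto (fun n : ℕ => (n : ℝ)) atTop atTop := tendsto_natCast_atTop_atTop
  have hε : Tendsto (fun n : ℕ => √(2 / ((n : ℝ) - 1))) atTop (𝓝[>] 0) := by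
    rw [tendsto_nhdsWithin_iff]
    constructor
    · have h := (tendsto_const_nhds (x := (2 : ℝ))).div_atTop
        (tendsto_atTop_add_const_right _ (-1) hn)
      simpa [sub_eq_add_neg] using h.sqrt
    · filter_upwards [eventually_ge_atTop 2] with n hn
      have : (2 : ℝ) ≤ n := by exact_mod_cast hn
      exact Real.sqrt_pos.2 (div_pos two_pos (by linarith))
  have hfactor : Tendsto (fun n : ℕ => (n : ℝ) / √(2 * n - 1) * √(2 / ((n : ℝ) - 1)))
      atTop (𝓝 1) := by
    have h0 := tendsto_inv_atTop_zero.comp hn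
    have h := (((h0.const_sub 1).mul ((h0.div_const 2).const_sub 1)).inv₀ (by norm_num)).sqrt
    norm_num at h
    refine h.congr' ?_
    filter_upwards [eventually_ge_atTop 2] with n hn
    have h2 : (2 : ℝ) ≤ n := by exact_mod_cast hn
    have h3 : (0 : ℝ) < n - 1 := by linarith
    have h4 : (0 : ℝ) < 2 * n - 1 := by linarith
    have e : (1 - (n : ℝ)⁻¹ / 2)⁻¹ * (1 - (n : ℝ)⁻¹)⁻¹ =
        (n : ℝ) ^ 2 / (2 * n - 1) * (2 / ((n : ℝ) - 1)) := by
      rw [← mul_inv, inv_eq_iff_eq_inv]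
      field_simp
    rw [e, Real.sqrt_mul (by positivity), Real.sqrt_div (sq_nonneg _), Real.sqrt_sq (by linarith)]
  have h := hfactor.mul ((tendsto_gammaMeasure_sub_stdNormalCDF_div z).comp hε)
  rw [one_mul] at h
  refine h.congr' ?_
  filter_upwards [eventually_ge_atTop 2] with n hn
  have h2 : (2 : ℝ) ≤ n := by exact_mod_cast hn
  have h3 : (0 : ℝ) < n - 1 := by linarith
  have hεpos : 0 < √(2 / ((n : ℝ) - 1)) := Real.sqrt_pos.2 (by positivity)
  have hsq : √(2 / ((n : ℝ) - 1)) ^ 2 = 2 / ((n : ℝ) - 1) := Real.sq_sqrt (by positivity)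
  have hprod : √(2 / ((n : ℝ) - 1)) * √(1 + 2 / ((n : ℝ) - 1) / 2) = √(2 * n) / (n - 1) := by
    rw [← Real.sqrt_mul (by positivity), eq_div_iff h3.ne',
      ← Real.sqrt_sq h3.le, ← Real.sqrt_mul (by positivity), Real.sqrt_sq h3.le]
    congr 1
    field_simp
    ring
  have hset : {w : ℝ | (w - ((n : ℝ) - 1)) / √(2 * n) ≤ z} =
      Set.Iic ((2 / ((n : ℝ) - 1))⁻¹ / (1 / 2) * (1 + z * √(2 / ((n : ℝ) - 1)) *
        √(1 + 2 / ((n : ℝ) - 1) / 2))) := by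
    ext w
    rw [Set.mem_ofPred_eq, Set.mem_Iic, div_le_iff₀ (Real.sqrt_pos.2 (by positivity)),
      sub_le_iff_le_add, mul_assoc z, hprod]
    congr! 1
    field_simp
    ring
  simp only [Function.comp, hsq]
  rw [hset, inv_div]
  field_simp
end
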